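/- arXiv:0810.2117 — 2 statements merged into one kernel-verified Lean document; each statement's English description precedes it below -/
import Mathlib

section
/- (Glueing 4^{×a}, 3^{×b} → 10.) Let d ≥ 0 and m_1,...,m_r, a, b be non-negative integers with 2a + b = 22. If the system L_3(d; m_1,...,m_r, 10) is non-special, then the system L_3(d; m_1,...,m_r, 4^{×a}, 3^{×b}) is non-special. (The virtual dimensions of the two systems agree, since 20a + 10b = 220 = C(10+2,3).) -/
open MvPolynomial

/-- The differential operator `∂₀^{ν 0} ∂₁^{ν 1} ∂₂^{ν 2} ∂₃^{ν 3}` on polynomials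
in 4 variables over `ℚ`. -/
noncomputable def diffOp (ν : Fin 4 → ℕ) :
    Module.End ℚ (MvPolynomial (Fin 4) ℚ) :=
  ((pderiv (0 : Fin 4)).toLinearMap ^ ν 0) * ((pderiv (1 : Fin 4)).toLinearMap ^ ν 1) *
    ((pderiv (2 : Fin 4)).toLinearMap ^ ν 2) * ((pderiv (3 : Fin 4)).toLinearMap ^ ν 3)

/-- Polynomials all of whose partial derivatives of order `< m` (including order 0)
vanish at the point `pt : ℚ⁴`. -/
noncomputable def vanishingSpace (m : ℕ) (pt : Fin 4 → ℚ) :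
    Submodule ℚ (MvPolynomial (Fin 4) ℚ) :=
  ⨅ (ν : Fin 4 → ℕ) (_ : ∑ j, ν j < m),
    LinearMap.ker ((aeval pt).toLinearMap ∘ₗ
      (diffOp ν : MvPolynomial (Fin 4) ℚ →ₗ[ℚ] MvPolynomial (Fin 4) ℚ))

/-- `V(d; m_1,…,m_r; p_1,…,p_r)`: homogeneous polynomials of degree `d` in 4 variables
over `ℚ` vanishing to order `≥ ms[i]` at `pts i` for each `i`. -/
noncomputable def systemSpace (d : ℕ) (ms : List ℕ) (pts : Fin ms.length → Fin 4 → ℚ) :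
    Submodule ℚ (MvPolynomial (Fin 4) ℚ) :=
  homogeneousSubmodule (Fin 4) ℚ d ⊓ ⨅ i, vanishingSpace (ms.get i) (pts i)

/-- The virtual dimension `vdim L_3(d; m_1,…,m_r) = C(d+3,3) − Σ C(m_i+2,3) − 1`. -/
def vdim (d : ℕ) (ms : List ℕ) : ℤ :=
  ((d + 3).choose 3 : ℤ) - (ms.map fun m => ((m + 2).choose 3 : ℤ)).sum - 1

/-- The linear system `L_3(d; m_1,…,m_r)` is non-special: there exist pairwise linearly
independent points of `ℚ⁴ \ {0}` at which the space of degree-`d` homogeneous polynomials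
with the prescribed multiplicities has dimension `max (vdim + 1) 0`
(the expected dimension). -/
noncomputable def nonSpecial (d : ℕ) (ms : List ℕ) : Prop :=
  ∃ pts : Fin ms.length → Fin 4 → ℚ,
    (∀ i, pts i ≠ 0) ∧
    (∀ i j, i ≠ j → LinearIndependent ℚ ![pts i, pts j]) ∧
    (Module.finrank ℚ (systemSpace d ms pts) : ℤ) = max (vdim d ms + 1) 0

namespace Glue

/-- Forces evaluation of a natural number in the kernel before continuing. -/
noncomputable def force {β : Type} (x : ℕ) (f : ℕ → β) : β :=
  Nat.rec (f 0) (fun n _ => f n.succ) x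

/-- The prime used. -/
def P : ℕ := 1009

/-- The packing base. -/
def B : ℕ := 268435456

noncomputable def normRow (u : ℕ) (n : ℕ) : ℕ → ℕ :=
  Nat.rec (fun _ => 0) (fun _ ih r =>
    Nat.add (Nat.mod (Nat.mul (Nat.mod r 268435456) u) 1009)
      (Nat.mul 268435456 (force (Nat.div r 268435456) ih))) n

noncomputable def stepAll (T : ℕ) (rows : List ℕ) : (List ℕ → Bool) → Bool :=
  List.rec (fun k => k []) (fun r _ ih k =>
    force (Nat.add (Nat.div r 268435456)
      (Nat.mul (Nat.sub 1009 (Nat.mod (Nat.mod r 268435456) 1009)) T)) fun x =>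
        ih fun ys => k (x :: ys)) rows

noncomputable def pick (rows : List ℕ) : (ℕ → List ℕ → Bool) → Bool :=
  List.rec (fun _ => false) (fun r rs ih k =>
    Bool.rec (k r rs) (ih fun x ys => k x (r :: ys))
      (Nat.beq (Nat.mod (Nat.mod r 268435456) 1009) 0)) rows

noncomputable def elim (n : ℕ) : List ℕ → Bool :=
  Nat.rec (fun _ => true) (fun n ih rows => pick rows fun r rest =>
    force (Nat.mod (Nat.pow (Nat.mod (Nat.mod r 268435456) 1009) 1007) 1009) fun u =>
      Bool.rec false
        (force (normRow u n (Nat.div r 268435456)) fun T => stepAll T rest ih)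
        (Nat.beq (Nat.mod (Nat.mul (Nat.mod r 268435456) u) 1009) 1)) n

noncomputable def yLoop (x Z : ℕ) (ys : List ℕ) : ℕ → ℕ → ℕ :=
  List.rec (fun _ tl => tl) (fun y _ ih n tl =>
    Nat.rec tl (fun n _ =>
      Nat.add (Nat.mul (Nat.mod (Nat.mul x y) 1009) (Nat.mod Z (Nat.pow 268435456 n.succ)))
        (Nat.mul (Nat.pow 268435456 n.succ) (ih n tl))) n) ys

noncomputable def xLoop (Z : ℕ) (ys : List ℕ) (xs : List ℕ) : ℕ → ℕ :=
  List.rec (fun _ => 0) (fun x _ ih n =>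
    Nat.rec 0 (fun n _ => yLoop x Z ys n.succ (ih n)) n) xs

/-- table of `a ↦ a (a-1) ⋯ (a-ν+1) x^(a-ν)` mod 1009 -/
def tab (x : ℕ) (ν : ℕ) (a : ℕ) : ℕ := (a.descFactorial ν * x ^ (a - ν)) % 1009

noncomputable def forceMap (f : ℕ → ℕ) (l : List ℕ) : (List ℕ → List ℕ) → List ℕ :=
  List.rec (fun k => k []) (fun a _ ih k => force (f a) fun x => ih fun ys => k (x :: ys)) l

noncomputable def packL (l : List ℕ) : ℕ :=
  List.rec 0 (fun a _ ih => Nat.add a (Nat.mul 268435456 ih)) l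

def tens : List ℕ := [0,1,2,3,4,5,6,7,8,9]

noncomputable def nus3 : List (ℕ × ℕ × ℕ) :=
  [(0,0,0),(0,0,1),(0,0,2),(0,1,0),(0,1,1),(0,2,0),(1,0,0),(1,0,1),(1,1,0),(2,0,0)]

noncomputable def nus4 : List (ℕ × ℕ × ℕ) :=
  [(0,0,3),(0,1,2),(0,2,1),(0,3,0),(1,0,2),(1,1,1),(1,2,0),(2,0,1),(2,1,0),(3,0,0)]

noncomputable def addRows (q : ℕ × ℕ × ℕ) (nus : List (ℕ × ℕ × ℕ)) (tl : List ℕ) : List ℕ :=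
  List.rec tl (fun ν _ ih =>
    forceMap (tab q.1 ν.1) tens fun xs => forceMap (tab q.2.1 ν.2.1) tens fun ys =>
    forceMap (tab q.2.2 ν.2.2) tens fun zs => 
    force (packL zs) fun Z => force (xLoop Z ys xs 10) fun r => r :: ih) nus

noncomputable def points : List (ℕ × ℕ × ℕ) := [(50, 98, 54), (6, 34, 66), (63, 52, 39), (62, 46, 75), (28, 65, 18), (37, 18, 97), (13, 80, 33), (69, 91, 78), (19, 40, 13), (94, 10, 88), (43, 61, 72), (13, 46, 56), (41, 79, 82), (27, 71, 62), (57, 67, 34), (8, 71, 2), (12, 93, 52), (91, 86, 81), (1, 79, 64), (43, 32, 94), (42, 91, 9), (25, 73, 29)]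

noncomputable def allRows (pts : List (ℕ × ℕ × ℕ)) : ℕ → ℕ → List ℕ :=
  List.rec (fun _ _ => []) (fun q _ ih a b =>
    Nat.rec (Nat.rec [] (fun b _ => addRows q nus3 (ih 0 b)) b)
      (fun a _ => addRows q nus3 (addRows q nus4 (ih a b))) a) pts

end Glue
namespace Glue

lemma force_eq {β : Type} (x : ℕ) (f : ℕ → β) : force x f = f x := by
  cases x <;> rfl

lemma normRow_zero (u r : ℕ) : normRow u 0 r = 0 := rfl

lemma normRow_succ (u n r : ℕ) :
    normRow u (n + 1) r = ((r % B) * u) % P + B * normRow u n (r / B) := by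
  have h : normRow u (n + 1) r = ((r % B) * u) % P + B * force (r / B) (normRow u n) := rfl
  rw [h, force_eq]

lemma stepAll_eq (T : ℕ) (rows : List ℕ) (k : List ℕ → Bool) :
    stepAll T rows k = k (rows.map fun r => r / B + (P - (r % B) % P) * T) := by
  induction rows generalizing k with
  | nil => rfl
  | cons r rs ih =>
    have h : stepAll T (r :: rs) k = force (r / B + (P - (r % B) % P) * T) fun x =>
        stepAll T rs fun ys => k (x :: ys) := rfl
    rw [h, force_eq, ih]
    rfl

lemma pick_sound (rows : List ℕ) (k : ℕ → List ℕ → Bool) (h : pick rows k = true) :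
    ∃ r rest, k r rest = true ∧ r ∈ rows ∧ ∀ s ∈ rest, s ∈ rows := by
  induction rows generalizing k with
  | nil => exact absurd h (by simp [pick])
  | cons r rs ih =>
    have e : pick (r :: rs) k = Bool.rec (k r rs) (pick rs fun x ys => k x (r :: ys))
      (Nat.beq ((r % B) % P) 0) := rfl
    rw [e] at h
    cases hb : Nat.beq ((r % B) % P) 0 with
    | false =>
      rw [hb] at h
      exact ⟨r, rs, h, by simp, fun s hs => by simp [hs]⟩
    | true =>
      rw [hb] at h
      obtain ⟨x, ys, h1, h2, h3⟩ := ih _ h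
      refine ⟨x, r :: ys, h1, by simp [h2], fun s hs => ?_⟩
      rcases List.mem_cons.1 hs with rfl | hs
      · simp
      · simp [h3 s hs]

lemma elim_succ (n : ℕ) (rows : List ℕ) (h : elim (n + 1) rows = true) :
    ∃ (r : ℕ) (rest : List ℕ) (u : ℕ), r ∈ rows ∧ (∀ s ∈ rest, s ∈ rows) ∧ ((r % B) * u) % P = 1 ∧
      elim n (rest.map fun s => s / B + (P - (s % B) % P) * normRow u n (r / B)) = true := by
  have e : elim (n + 1) rows = pick rows fun r rest =>
    force (((r % B) % P) ^ 1007 % P) fun u =>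
      Bool.rec false
        (force (normRow u n (r / B)) fun T => stepAll T rest (elim n))
        (Nat.beq (((r % B) * u) % P) 1) := rfl
  rw [e] at h
  obtain ⟨r, rest, h1, h2, h3⟩ := pick_sound _ _ h
  rw [force_eq] at h1
  generalize hu : ((r % B) % P) ^ 1007 % P = u at h1
  refine ⟨r, rest, u, h2, h3, ?_⟩
  cases hb : Nat.beq (((r % B) * u) % P) 1 with
  | false => rw [hb] at h1; exact absurd h1 (by simp)
  | true =>
    rw [hb] at h1
    refine ⟨Nat.eq_of_beq_eq_true hb, ?_⟩
    have h1' : (force (normRow u n (r / B)) fun T => stepAll T rest (elim n)) = true := h1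
    rw [force_eq, stepAll_eq] at h1'
    exact h1'

/-- Scalar product mod `P`. -/
def dot : List ℕ → List (ZMod P) → ZMod P
  | e :: es, x :: xs => (e : ZMod P) * x + dot es xs
  | _, _ => 0

/-- `r` is a packed row, with entries at most `K`, orthogonal to `v`. -/
def Good (K : ℕ) (v : List (ZMod P)) (r : ℕ) : Prop :=
  ∃ es : List ℕ, es.length = v.length ∧ (∀ e ∈ es, e ≤ K) ∧ Nat.ofDigits B es = r ∧ dot es v = 0

lemma normRow_ofDigits (u : ℕ) (es : List ℕ) (h : ∀ e ∈ es, e < B) :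
    normRow u es.length (Nat.ofDigits B es) = Nat.ofDigits B (es.map fun e => e * u % P) := by
  induction es with
  | nil => rfl
  | cons e es ih =>
    have he : e < B := h e (by simp)
    have hB : 0 < B := by decide
    rw [List.length_cons, normRow_succ, Nat.ofDigits_cons, List.map_cons, Nat.ofDigits_cons,
      Nat.add_mul_mod_self_left, Nat.mod_eq_of_lt he, Nat.add_mul_div_left _ _ hB,
      Nat.div_eq_of_lt he, zero_add, ih fun x hx => h x (by simp [hx])]

lemma ofDigits_comb (c : ℕ) (es fs : List ℕ) (h : es.length = fs.length) :
    Nat.ofDigits B es + c * Nat.ofDigits B fs =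
      Nat.ofDigits B (List.zipWith (fun e f => e + c * f) es fs) := by
  induction es generalizing fs with
  | nil => cases fs with
    | nil => simp
    | cons => simp at h
  | cons e es ih => cases fs with
    | nil => simp at h
    | cons f fs =>
      rw [List.zipWith_cons_cons, Nat.ofDigits_cons, Nat.ofDigits_cons, Nat.ofDigits_cons,
        ← ih fs (by simpa using h)]
      push_cast
      ring

lemma dot_comb (c : ℕ) (es fs : List ℕ) (v : List (ZMod P)) (h : es.length = fs.length) :
    dot (List.zipWith (fun e f => e + c * f) es fs) v = dot es v + c * dot fs v := by
  induction es generalizing fs v with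
  | nil => cases fs with
    | nil => simp [dot]
    | cons => simp at h
  | cons e es ih => cases fs with
    | nil => simp at h
    | cons f fs => cases v with
      | nil => simp [dot]
      | cons x v =>
        simp only [List.zipWith_cons_cons, dot, ih fs v (by simpa using h)]
        push_cast
        ring

lemma dot_map_mul (u : ℕ) (es : List ℕ) (v : List (ZMod P)) :
    dot (es.map fun e => e * u % P) v = u * dot es v := by
  induction es generalizing v with
  | nil => simp [dot]
  | cons e es ih => cases v with
    | nil => simp [dot]
    | cons x v =>
      simp only [List.map_cons, dot, ih]
      rw [ZMod.natCast_mod]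
      push_cast
      ring

lemma elim_sound (n : ℕ) (v : List (ZMod P)) (rows : List ℕ) (K : ℕ) (hK : K + n * (P * P) < B)
    (hv : v.length = n) (h : elim n rows = true) (hr : ∀ r ∈ rows, Good K v r) :
    ∀ x ∈ v, x = 0 := by
  induction n generalizing v rows K with
  | zero => rw [List.length_eq_zero_iff] at hv; simp [hv]
  | succ n ih =>
    obtain ⟨r, rest, u, h1, h2, h3, h4⟩ := elim_succ n rows h
    cases v with
    | nil => simp at hv
    | cons x v =>
    have hv' : v.length = n := by simpa using hv
    have hB : 0 < B := by decide
    have hP : 0 < P := by decide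
    have hKB : K < B := by omega
    obtain ⟨es, e1, e2, e3, e4⟩ := hr r h1
    cases es with
    | nil => simp at e1
    | cons e es =>
    have e1' : es.length = v.length := by simpa using e1
    have heB : e < B := lt_of_le_of_lt (e2 e (by simp)) hKB
    have hrm : r % B = e := by
      rw [← e3, Nat.ofDigits_cons, Nat.add_mul_mod_self_left]
      exact Nat.mod_eq_of_lt heB
    have hrd : r / B = Nat.ofDigits B es := by
      rw [← e3, Nat.ofDigits_cons, Nat.add_mul_div_left _ _ hB]
      simp [Nat.div_eq_of_lt heB]
    have heu : (e : ZMod P) * u = 1 := by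
      have : ((e * u % P : ℕ) : ZMod P) = 1 := by rw [← hrm, h3]; simp
      rw [ZMod.natCast_mod] at this
      exact_mod_cast this
    set T := es.map fun e => e * u % P with hT
    have hTn : normRow u n (r / B) = Nat.ofDigits B T := by
      rw [hrd, ← hv', ← e1', normRow_ofDigits]
      exact fun y hy => lt_of_le_of_lt (e2 y (by simp [hy])) hKB
    have hTl : T.length = v.length := by simp [hT, e1']
    have hTd : x = - dot T v := by
      rw [hT, dot_map_mul]
      have e4' : (e : ZMod P) * x + dot es v = 0 := e4
      linear_combination (u : ZMod P) * e4' - x * heu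
    have hvz : ∀ y ∈ v, y = 0 := by
      refine ih v _ (K + P * P) ?_ hv' h4 ?_
      · rw [Nat.succ_mul] at hK; omega
      · intro s' hs'
        obtain ⟨s, hs, rfl⟩ := List.mem_map.1 hs'
        obtain ⟨fs, f1, f2, f3, f4⟩ := hr s (h2 s hs)
        cases fs with
        | nil => simp at f1
        | cons f fs =>
        have f1' : fs.length = v.length := by simpa using f1
        have hfB : f < B := lt_of_le_of_lt (f2 f (by simp)) hKB
        have hsm : s % B = f := by
          rw [← f3, Nat.ofDigits_cons, Nat.add_mul_mod_self_left]
          exact Nat.mod_eq_of_lt hfB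
        have hsd : s / B = Nat.ofDigits B fs := by
          rw [← f3, Nat.ofDigits_cons, Nat.add_mul_div_left _ _ hB]
          simp [Nat.div_eq_of_lt hfB]
        have hl : fs.length = T.length := by rw [f1', hTl]
        refine ⟨List.zipWith (fun e f' => e + (P - f % P) * f') fs T, ?_, ?_, ?_, ?_⟩
        · simp [hl, hTl]
        · intro y hy
          rw [List.mem_iff_getElem] at hy
          obtain ⟨i, hi, rfl⟩ := hy
          rw [List.getElem_zipWith]
          refine Nat.add_le_add (f2 _ (by simp)) (Nat.mul_le_mul (Nat.sub_le _ _) ?_)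
          rw [List.getElem_map]
          exact (Nat.mod_lt _ hP).le
        · rw [hTn, hsd, hsm, ofDigits_comb _ _ _ hl]
        · rw [dot_comb _ _ _ _ hl]
          have f4' : (f : ZMod P) * x + dot fs v = 0 := f4
          rw [Nat.cast_sub (Nat.mod_lt _ hP).le, ZMod.natCast_mod, ZMod.natCast_self]
          rw [hTd] at f4'
          linear_combination f4'
    have hd0 : ∀ (es : List ℕ) (v : List (ZMod P)), (∀ y ∈ v, y = 0) → dot es v = 0 := by
      intro es
      induction es with
      | nil => intro v _; simp [dot]
      | cons e es ih => intro v hv; cases v with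
        | nil => simp [dot]
        | cons x v =>
          rw [dot, ih v fun y hy => hv y (by simp [hy]), hv x (by simp)]
          simp
    intro y hy
    rcases List.mem_cons.1 hy with rfl | hy
    · rw [hTd, hd0 T v hvz, neg_zero]
    · exact hvz y hy

end Glue
namespace Glue

lemma forceMap_eq (f : ℕ → ℕ) (l : List ℕ) (k : List ℕ → List ℕ) :
    forceMap f l k = k (l.map f) := by
  induction l generalizing k with
  | nil => rfl
  | cons a l ih =>
    have h : forceMap f (a :: l) k = force (f a) fun x => forceMap f l fun ys => k (x :: ys) := rfl
    rw [h, force_eq, ih]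
    rfl

lemma packL_eq (l : List ℕ) : packL l = Nat.ofDigits B l := by
  induction l with
  | nil => rfl
  | cons a l ih =>
    have h : packL (a :: l) = a + B * packL l := rfl
    rw [h, ih, Nat.ofDigits_cons]

/-- list version of `yLoop` -/
def yL (x : ℕ) (zs : List ℕ) : List ℕ → ℕ → List ℕ → List ℕ
  | y :: ys, n + 1, tl => (zs.take (n + 1)).map (fun z => (x * y % 1009) * z) ++ yL x zs ys n tl
  | _, _, tl => tl

/-- list version of `xLoop` -/
def xL (zs ys : List ℕ) : List ℕ → ℕ → List ℕ
  | x :: xs, n + 1 => yL x zs ys (n + 1) (xL zs ys xs n)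
  | _, _ => []

lemma ofDigits_map_mul (c : ℕ) (l : List ℕ) :
    Nat.ofDigits B (l.map fun z => c * z) = c * Nat.ofDigits B l := by
  induction l with
  | nil => simp
  | cons a l ih =>
    rw [List.map_cons, Nat.ofDigits_cons, Nat.ofDigits_cons, ih]
    ring

lemma yLoop_eq (x : ℕ) (zs : List ℕ) (hz : ∀ z ∈ zs, z < B) (ys : List ℕ) (n : ℕ) (tl : List ℕ)
    (hn : n ≤ zs.length) :
    yLoop x (Nat.ofDigits B zs) ys n (Nat.ofDigits B tl) = Nat.ofDigits B (yL x zs ys n tl) := by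
  induction ys generalizing n with
  | nil => simp only [yL]; rfl
  | cons y ys ih => cases n with
    | zero => simp only [yL]; rfl
    | succ n =>
      have h : yLoop x (Nat.ofDigits B zs) (y :: ys) (n + 1) (Nat.ofDigits B tl) =
        (x * y % 1009) * (Nat.ofDigits B zs % B ^ (n + 1)) +
          B ^ (n + 1) * yLoop x (Nat.ofDigits B zs) ys n (Nat.ofDigits B tl) := rfl
      rw [h, ih n (by omega), yL, Nat.ofDigits_append, ofDigits_map_mul,
        Nat.ofDigits_mod_pow_eq_ofDigits_take (n + 1) (by decide) zs hz]
      simp [hn]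

lemma xLoop_eq (zs : List ℕ) (hz : ∀ z ∈ zs, z < B) (ys xs : List ℕ) (n : ℕ)
    (hn : n ≤ zs.length) :
    xLoop (Nat.ofDigits B zs) ys xs n = Nat.ofDigits B (xL zs ys xs n) := by
  induction xs generalizing n with
  | nil => simp only [xL]; rfl
  | cons x xs ih => cases n with
    | zero => simp only [xL]; rfl
    | succ n =>
      have h : xLoop (Nat.ofDigits B zs) ys (x :: xs) (n + 1) =
        yLoop x (Nat.ofDigits B zs) ys (n + 1) (xLoop (Nat.ofDigits B zs) ys xs n) := rfl
      rw [h, ih n (by omega), xL, yLoop_eq x zs hz _ _ _ hn]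

/-- exponents of the monomials of degree at most 9 -/
def mons : List (ℕ × ℕ × ℕ) :=
  (List.range 10).flatMap fun a => (List.range (10 - a)).flatMap fun b =>
    (List.range (10 - a - b)).map fun c => (a, b, c)

lemma mons_length : mons.length = 220 := by decide +kernel

lemma mons_nodup : mons.Nodup := by decide +kernel

lemma mem_mons (α : ℕ × ℕ × ℕ) (h : α.1 + α.2.1 + α.2.2 ≤ 9) : α ∈ mons := by
  obtain ⟨a, b, c⟩ := α
  simp only at h
  simp only [mons, List.mem_flatMap, List.mem_range, List.mem_map, Prod.mk.injEq]
  exact ⟨a, by omega, b, by omega, c, by omega, rfl, rfl, rfl⟩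

set_option maxRecDepth 100000 in
lemma xL_eq (X Y Z : ℕ → ℕ) :
    xL (tens.map Z) (tens.map Y) (tens.map X) 10 =
      mons.map fun α => (X α.1 * Y α.2.1 % 1009) * Z α.2.2 := by
  rfl

/-- the packed row of the condition given by point `s.1` and derivative `s.2` -/
noncomputable def rowVal (s : (ℕ × ℕ × ℕ) × (ℕ × ℕ × ℕ)) : ℕ :=
  Nat.ofDigits B (mons.map fun α =>
    (tab s.1.1 s.2.1 α.1 * tab s.1.2.1 s.2.2.1 α.2.1 % 1009) * tab s.1.2.2 s.2.2.2 α.2.2)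

lemma addRows_eq (q : ℕ × ℕ × ℕ) (nus : List (ℕ × ℕ × ℕ)) (tl : List ℕ) :
    addRows q nus tl = nus.map (fun ν => rowVal (q, ν)) ++ tl := by
  induction nus with
  | nil => rfl
  | cons ν nus ih =>
    have h : addRows q (ν :: nus) tl = 
      forceMap (tab q.1 ν.1) tens fun xs => forceMap (tab q.2.1 ν.2.1) tens fun ys =>
      forceMap (tab q.2.2 ν.2.2) tens fun zs => 
      force (packL zs) fun Z => force (xLoop Z ys xs 10) fun r => r :: addRows q nus tl := rfl
    rw [h, forceMap_eq, forceMap_eq, forceMap_eq, force_eq, force_eq, packL_eq, xLoop_eq, xL_eq,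
      List.map_cons, ih]
    · rfl
    · intro z hz
      obtain ⟨a, -, rfl⟩ := List.mem_map.1 hz
      exact lt_trans (Nat.mod_lt _ (by decide)) (by decide)
    · simp [tens]

/-- list of all conditions -/
noncomputable def spec : List (ℕ × ℕ × ℕ) → ℕ → ℕ → List ((ℕ × ℕ × ℕ) × (ℕ × ℕ × ℕ))
  | [], _, _ => []
  | _ :: _, 0, 0 => []
  | q :: pts, 0, b + 1 => nus3.map (fun ν => (q, ν)) ++ spec pts 0 b
  | q :: pts, a + 1, b =>
    nus3.map (fun ν => (q, ν)) ++ (nus4.map (fun ν => (q, ν)) ++ spec pts a b)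

lemma allRows_eq (pts : List (ℕ × ℕ × ℕ)) (a b : ℕ) :
    allRows pts a b = (spec pts a b).map rowVal := by
  induction pts generalizing a b with
  | nil => simp only [spec]; rfl
  | cons q pts ih =>
    cases a with
    | zero => cases b with
      | zero => simp only [spec]; rfl
      | succ b =>
        have h : allRows (q :: pts) 0 (b + 1) = addRows q nus3 (allRows pts 0 b) := rfl
        rw [h, addRows_eq, ih, spec, List.map_append, List.map_map]
        rfl
    | succ a =>
      have h : allRows (q :: pts) (a + 1) b =
        addRows q nus3 (addRows q nus4 (allRows pts a b)) := rfl
      rw [h, addRows_eq, addRows_eq, ih, spec, List.map_append, List.map_append, List.map_map,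
        List.map_map]
      rfl

lemma spec_length (pts : List (ℕ × ℕ × ℕ)) (a b : ℕ) (h : a + b ≤ pts.length) :
    (spec pts a b).length = 20 * a + 10 * b := by
  induction pts generalizing a b with
  | nil =>
    simp only [List.length_nil] at h
    obtain ⟨rfl, rfl⟩ : a = 0 ∧ b = 0 := by omega
    simp [spec]
  | cons q pts ih =>
    simp only [List.length_cons] at h
    cases a with
    | zero => cases b with
      | zero => simp [spec]
      | succ b => simp [spec, ih 0 b (by omega), nus3]; omega
    | succ a => simp [spec, ih a b (by omega), nus3, nus4]; omega

lemma spec_mem (pts : List (ℕ × ℕ × ℕ)) (a b : ℕ) (s) (hs : s ∈ spec pts a b) :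
    ∃ j, ∃ hj : j < pts.length, j < a + b ∧ s.1 = pts[j] ∧
      s.2.1 + s.2.2.1 + s.2.2.2 < if j < a then 4 else 3 := by
  induction pts generalizing a b with
  | nil => simp [spec] at hs
  | cons q pts ih =>
    have key : ∀ a' b' : ℕ, s ∈ spec pts a' b' → a' + b' + 1 = a + b → (∀ j, j < a' ↔ j + 1 < a) →
      ∃ j, ∃ hj : j < (q :: pts).length, j < a + b ∧ s.1 = (q :: pts)[j] ∧
      s.2.1 + s.2.2.1 + s.2.2.2 < if j < a then 4 else 3 := by
      intro a' b' h1 h2 h3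
      obtain ⟨j, hj, h4, h5, h6⟩ := ih a' b' h1
      refine ⟨j + 1, by simpa using hj, by omega, by simpa using h5, ?_⟩
      simpa only [← h3 j] using h6
    have h3 : ∀ ν ∈ nus3, ν.1 + ν.2.1 + ν.2.2 < 3 := by simp [nus3]
    have h4 : ∀ ν ∈ nus4, ν.1 + ν.2.1 + ν.2.2 < 4 := by simp [nus4]
    cases a with
    | zero => cases b with
      | zero => simp [spec] at hs
      | succ b =>
        rw [spec, List.mem_append] at hs
        rcases hs with hs | hs
        · obtain ⟨ν, hν, rfl⟩ := List.mem_map.1 hs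
          exact ⟨0, by simp, by omega, rfl, by simpa using h3 ν hν⟩
        · exact key 0 b hs (by omega) (by simp)
    | succ a =>
      rw [spec, List.mem_append, List.mem_append] at hs
      rcases hs with hs | hs | hs
      · obtain ⟨ν, hν, rfl⟩ := List.mem_map.1 hs
        exact ⟨0, by simp, by omega, rfl, by
          have := h3 ν hν
          simp only [Nat.zero_lt_succ, if_true]; omega⟩
      · obtain ⟨ν, hν, rfl⟩ := List.mem_map.1 hs
        exact ⟨0, by simp, by omega, rfl, by simpa using h4 ν hν⟩
      · exact key a b hs (by omega) (by simp)

/-- unreduced entry of the matrix of conditions -/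
def entry (s : (ℕ × ℕ × ℕ) × (ℕ × ℕ × ℕ)) (α : ℕ × ℕ × ℕ) : ℕ :=
  (α.1.descFactorial s.2.1 * s.1.1 ^ (α.1 - s.2.1)) *
  (α.2.1.descFactorial s.2.2.1 * s.1.2.1 ^ (α.2.1 - s.2.2.1)) *
  (α.2.2.descFactorial s.2.2.2 * s.1.2.2 ^ (α.2.2 - s.2.2.2))

lemma dot_map {ι : Type} (l : List ι) (e : ι → ℕ) (w : ι → ZMod P) :
    dot (l.map e) (l.map w) = (l.map fun i => (e i : ZMod P) * w i).sum := by
  induction l with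
  | nil => simp [dot]
  | cons a l ih => simp [dot, ih]

instance : Fact (Nat.Prime P) := ⟨by norm_num [P]⟩

theorem check_all : ∀ a ∈ List.range 12, elim 220 (allRows points a (22 - 2 * a)) = true := by
  decide +kernel

lemma dot_ofFn {ι : Type} (l : List ι) (e : ι → ℕ) (v : Fin l.length → ZMod P) :
    dot (l.map e) (List.ofFn v) = ∑ j, (e (l.get j) : ZMod P) * v j := by
  have h1 : l.map e = (List.finRange l.length).map (fun j => e (l.get j)) := by
    rw [← List.ofFn_eq_map]
    apply List.ext_get
    · simp
    · intro n h1 h2; simp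
  rw [h1, List.ofFn_eq_map (f := v), dot_map, ← List.ofFn_eq_map, List.sum_ofFn]

lemma dot_congr {ι : Type} (l : List ι) (e e' : ι → ℕ) (h : ∀ i, (e i : ZMod P) = e' i)
    (v : List (ZMod P)) : dot (l.map e) v = dot (l.map e') v := by
  induction l generalizing v with
  | nil => rfl
  | cons a l ih => cases v with
    | nil => rfl
    | cons x v => simp [dot, h, ih]

lemma sum_get {ι R : Type} [CommRing R] (l : List ι) (f : ι → R) :
    (l.map f).sum = ∑ j, f (l.get j) := by
  rw [← List.sum_ofFn]
  congr 1
  apply List.ext_get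
  · simp
  · intro n h1 h2; simp

lemma core_gen {ι σ : Type} (l : List ι) (S : List σ) (hlen : S.length = l.length) (e : σ → ι → ℕ)
    (hmod : ∀ v : List (ZMod P), v.length = l.length → (∀ s ∈ S, dot (l.map (e s)) v = 0) →
      ∀ x ∈ v, x = 0)
    (c : ι → ℚ) (hc : ∀ s ∈ S, (l.map fun α => (e s α : ℚ) * c α).sum = 0) :
    ∀ α ∈ l, c α = 0 := by
  let M : Matrix (Fin l.length) (Fin l.length) ℤ :=
    Matrix.of fun i j => (e (S.get (i.cast hlen.symm)) (l.get j) : ℤ)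
  have hdet : ((Int.castRingHom (ZMod P)).mapMatrix M).det ≠ 0 := by
    intro h0
    obtain ⟨v, hv0, hv⟩ := Matrix.exists_mulVec_eq_zero_iff.2 h0
    apply hv0
    have := hmod (List.ofFn v) (by simp) ?_
    · funext j
      exact this _ (by simp)
    · intro s hs
      obtain ⟨i, rfl⟩ := List.get_of_mem hs
      have hi := congrFun hv (i.cast hlen)
      simp only [Matrix.mulVec, dotProduct, Pi.zero_apply] at hi
      rw [← hi, dot_ofFn]
      refine Finset.sum_congr rfl fun j _ => ?_
      simp [M]
  have hdetZ : M.det ≠ 0 := by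
    intro h
    apply hdet
    rw [← RingHom.map_det, h, map_zero]
  have hdetQ : ((Int.castRingHom ℚ).mapMatrix M).det ≠ 0 := by
    rw [← RingHom.map_det]
    simpa using hdetZ
  have hz : (fun j => c (l.get j)) = 0 := by
    by_contra hne
    apply hdetQ
    refine Matrix.exists_mulVec_eq_zero_iff.1 ⟨_, hne, ?_⟩
    funext i
    have := hc (S.get (i.cast hlen.symm)) (List.get_mem _ _)
    rw [sum_get] at this
    simp only [Matrix.mulVec, dotProduct, Pi.zero_apply]
    rw [← this]
    refine Finset.sum_congr rfl fun j _ => ?_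
    simp [M]
  intro α hα
  obtain ⟨j, rfl⟩ := List.get_of_mem hα
  exact congrFun hz j

lemma points_length : points.length = 22 := by simp [points]

/-- The linear algebra core: the conditions determine a polynomial of degree at most 9. -/
theorem core (a b : ℕ) (hab : 2 * a + b = 22) (c : ℕ × ℕ × ℕ → ℚ)
    (hc : ∀ s ∈ spec points a b, (mons.map fun α => (entry s α : ℚ) * c α).sum = 0) :
    ∀ α ∈ mons, c α = 0 := by
  refine core_gen mons (spec points a b) ?_ entry ?_ c hc
  · rw [spec_length _ _ _ (by rw [points_length]; omega), mons_length]
    omega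
  · intro v hv hs
    have hchk : elim 220 (allRows points a b) = true := by
      have := check_all a (by rw [List.mem_range]; omega)
      rwa [show 22 - 2 * a = b by omega] at this
    have hK : P * P + 220 * (P * P) < B := by decide
    refine elim_sound 220 v _ (P * P) hK (by rw [hv, mons_length]) hchk ?_
    intro r hr
    rw [allRows_eq] at hr
    obtain ⟨s, hs', rfl⟩ := List.mem_map.1 hr
    refine ⟨_, ?_, ?_, rfl, ?_⟩
    · rw [hv, List.length_map]
    · intro e he
      obtain ⟨α, -, rfl⟩ := List.mem_map.1 he
      exact Nat.mul_le_mul (Nat.mod_lt _ (by decide)).le (Nat.mod_lt _ (by decide)).le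
    · rw [← hs s hs']
      apply dot_congr
      intro α
      simp only [entry, tab]
      rw [show (1009 : ℕ) = P from rfl]
      push_cast [ZMod.natCast_mod]
      rfl

end Glue
namespace Glue
open MvPolynomial

/-- `G` vanishes to order `m` at `q`. -/
def Van {σ : Type} : ℕ → MvPolynomial σ ℚ → (σ → ℚ) → Prop
  | 0, _, _ => True
  | m + 1, G, q => eval q G = 0 ∧ ∀ i, Van m (pderiv i G) q

section
variable {σ τ : Type}

lemma Van.zero (m : ℕ) (q : σ → ℚ) : Van m (0 : MvPolynomial σ ℚ) q := by
  induction m with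
  | zero => trivial
  | succ m ih => exact ⟨by simp, fun i => by simpa using ih⟩

lemma Van.add {m : ℕ} {F G : MvPolynomial σ ℚ} {q : σ → ℚ} (hF : Van m F q) (hG : Van m G q) :
    Van m (F + G) q := by
  induction m generalizing F G with
  | zero => trivial
  | succ m ih =>
    exact ⟨by simp [hF.1, hG.1], fun i => by rw [map_add]; exact ih (hF.2 i) (hG.2 i)⟩

lemma Van.smul {m : ℕ} {F : MvPolynomial σ ℚ} {q : σ → ℚ} (c : ℚ) (hF : Van m F q) :
    Van m (c • F) q := by
  induction m generalizing F with
  | zero => trivial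
  | succ m ih =>
    exact ⟨by simp [hF.1], fun i => by rw [Derivation.map_smul]; exact ih (hF.2 i)⟩

lemma Van.sum {ι : Type} {m : ℕ} {q : σ → ℚ} (s : Finset ι) (F : ι → MvPolynomial σ ℚ)
    (h : ∀ i ∈ s, Van m (F i) q) : Van m (∑ i ∈ s, F i) q := by
  classical
  induction s using Finset.induction_on with
  | empty => simpa using Van.zero m q
  | insert a s ha ih =>
    rw [Finset.sum_insert ha]
    exact (h a (by simp)).add (ih fun i hi => h i (by simp [hi]))

lemma Van.pred {m : ℕ} {F : MvPolynomial σ ℚ} {q : σ → ℚ} (h : Van (m + 1) F q) : Van m F q := by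
  induction m generalizing F with
  | zero => trivial
  | succ m ih => exact ⟨h.1, fun i => ih (h.2 i)⟩

lemma Van.mul {m : ℕ} {F : MvPolynomial σ ℚ} {q : σ → ℚ} (H : MvPolynomial σ ℚ) (h : Van m F q) :
    Van m (H * F) q := by
  induction m generalizing F H with
  | zero => trivial
  | succ m ih =>
    refine ⟨by simp [h.1], fun i => ?_⟩
    rw [Derivation.leibniz]
    exact (ih H (h.2 i)).add (by rw [smul_eq_mul, mul_comm]; exact ih _ h.pred)

/-- chain rule -/
lemma pderiv_aeval [Fintype σ] (f : σ → MvPolynomial τ ℚ) (j : τ) (F : MvPolynomial σ ℚ) :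
    pderiv j (aeval f F) = ∑ i, pderiv j (f i) * aeval f (pderiv i F) := by
  classical
  induction F using MvPolynomial.induction_on with
  | C a => simp
  | add p q hp hq => simp only [map_add, hp, hq, mul_add, Finset.sum_add_distrib]
  | mul_X p k hp =>
    simp only [map_mul, aeval_X, Derivation.leibniz, hp, smul_eq_mul, pderiv_X, map_add, mul_add,
      Finset.sum_add_distrib, Finset.mul_sum]
    congr 1
    · rw [Finset.sum_eq_single k]
      · simp; ring
      · intro b _ hb
        simp [hb.symm]
      · simp
    · refine Finset.sum_congr rfl fun i _ => by ring

lemma Van.comp [Fintype σ] {m : ℕ} {F : MvPolynomial σ ℚ} {p : σ → ℚ} (h : Van m F p)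
    (f : σ → MvPolynomial τ ℚ) (q : τ → ℚ) (hf : ∀ i, eval q (f i) = p i) :
    Van m (aeval f F) q := by
  induction m generalizing F with
  | zero => trivial
  | succ m ih =>
    refine ⟨?_, fun j => ?_⟩
    · have : (eval q) (aeval f F) = eval p F := by
        rw [← MvPolynomial.coe_aeval_eq_eval, ← MvPolynomial.coe_aeval_eq_eval]
        have : ((aeval q : MvPolynomial τ ℚ →ₐ[ℚ] ℚ).comp (aeval f)) = aeval p := by
          apply MvPolynomial.algHom_ext
          intro i
          simpa using hf i
        exact DFunLike.congr_fun this F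
      rw [this]; exact h.1
    · rw [pderiv_aeval]
      exact Van.sum _ _ fun i _ => Van.mul _ (ih (h.2 i))

lemma Van.coeff_zero {m : ℕ} {G : MvPolynomial σ ℚ} (h : Van m G 0) (μ : σ →₀ ℕ)
    (hμ : μ.degree < m) : coeff μ G = 0 := by
  classical
  induction m generalizing G μ with
  | zero => omega
  | succ m ih =>
    by_cases h0 : μ = 0
    · subst h0
      have := h.1
      rw [← MvPolynomial.constantCoeff_eq]
      rwa [show (eval (0 : σ → ℚ)) G = constantCoeff G by
        rw [MvPolynomial.eval_zero]] at this
    · obtain ⟨i, hi⟩ : ∃ i, μ i ≠ 0 := by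
        by_contra hh
        push Not at hh
        exact h0 (Finsupp.ext hh)
      obtain ⟨μ', rfl⟩ : ∃ μ', μ = μ' + Finsupp.single i 1 :=
        ⟨μ - Finsupp.single i 1, (tsub_add_cancel_of_le (by
          rw [Finsupp.single_le_iff]; omega)).symm⟩
      have hd : μ'.degree < m := by
        simp only [map_add, Finsupp.degree_single] at hμ
        omega
      have := ih (h.2 i) μ' hd
      rw [coeff_pderiv] at this
      rcases mul_eq_zero.1 this with h1 | h1
      · exact h1
      · exfalso
        have : (0 : ℚ) < (μ' i : ℚ) + 1 := by positivity
        linarith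

lemma Van.of_coeff {m : ℕ} {G : MvPolynomial σ ℚ} (h : ∀ μ : σ →₀ ℕ, μ.degree < m → coeff μ G = 0) :
    Van m G 0 := by
  induction m generalizing G with
  | zero => trivial
  | succ m ih =>
    refine ⟨?_, fun i => ih fun μ hμ => ?_⟩
    · have := h 0 (by simp)
      rw [MvPolynomial.eval_zero]
      exact this
    · rw [coeff_pderiv, h _ (by simp only [map_add, Finsupp.degree_single]; omega), zero_mul]

end

lemma pderiv_comm' {σ : Type} (i j : σ) (F : MvPolynomial σ ℚ) :
    pderiv i (pderiv j F) = pderiv j (pderiv i F) := by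
  classical
  ext μ
  simp only [coeff_pderiv]
  rw [add_right_comm]
  by_cases h : i = j
  · subst h; rfl
  · simp [h, Ne.symm h]
    ring

lemma diffOp_succ (ν : Fin 4 → ℕ) (i : Fin 4) (F : MvPolynomial (Fin 4) ℚ) :
    diffOp (ν + Pi.single i 1) F = diffOp ν (pderiv i F) := by
  have hc : ∀ i j : Fin 4, Commute ((pderiv i).toLinearMap : Module.End ℚ (MvPolynomial (Fin 4) ℚ))
      (pderiv j).toLinearMap := by
    intro i j
    apply LinearMap.ext
    intro a
    exact pderiv_comm' i j a
  have : diffOp (ν + Pi.single i 1) = diffOp ν * (pderiv i).toLinearMap := by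
    unfold diffOp
    have h0 := fun j n => ((hc 0 j).pow_right n).eq
    have h1 := fun j n => ((hc 1 j).pow_right n).eq
    have h2 := fun j n => ((hc 2 j).pow_right n).eq
    fin_cases i
    · simp [pow_succ, mul_assoc, h0]
    · simp [pow_succ, mul_assoc, h1]
    · simp [pow_succ, mul_assoc, h2]
    · simp [pow_succ, mul_assoc]
  rw [this]; rfl

lemma mem_vanishingSpace (m : ℕ) (p : Fin 4 → ℚ) (F : MvPolynomial (Fin 4) ℚ) :
    F ∈ vanishingSpace m p ↔ Van m F p := by
  have hmem : ∀ m F, F ∈ vanishingSpace m p ↔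
      ∀ ν : Fin 4 → ℕ, ∑ j, ν j < m → eval p (diffOp ν F) = 0 := by
    intro m F
    simp only [vanishingSpace, Submodule.mem_iInf, LinearMap.mem_ker, LinearMap.comp_apply]
    rfl
  induction m generalizing F with
  | zero => simp [hmem, Van]
  | succ m ih =>
    rw [Van]
    simp_rw [← ih, hmem]
    constructor
    · intro h
      refine ⟨?_, fun i ν hν => ?_⟩
      · have := h 0 (by simp)
        simpa [diffOp] using this
      · rw [← diffOp_succ]
        apply h
        simp only [Pi.add_apply, Finset.sum_add_distrib, Finset.sum_pi_single', Finset.mem_univ,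
          if_true]
        omega
    · rintro ⟨h0, h1⟩ ν hν
      by_cases hz : ν = 0
      · subst hz
        simpa [diffOp] using h0
      · obtain ⟨i, hi⟩ : ∃ i, ν i ≠ 0 := by
          by_contra hh
          push Not at hh
          exact hz (funext hh)
        obtain ⟨ν', rfl⟩ : ∃ ν', ν = ν' + Pi.single i 1 :=
          ⟨ν - Pi.single i 1, by
            funext j
            by_cases hj : j = i
            · subst hj; simp; omega
            · simp [hj]⟩
        rw [diffOp_succ]
        apply h1
        simp only [Pi.add_apply, Finset.sum_add_distrib, Finset.sum_pi_single', Finset.mem_univ,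
          if_true] at hν
        omega

/-- the coordinates of the affine chart around `p` in the hyperplane `x_{i} = p_i` -/
noncomputable def chart (p : Fin 4 → ℚ) (i : Fin 4) : Fin 4 → MvPolynomial (Fin 3) ℚ :=
  i.insertNth (C (p i)) (fun j => C (p (i.succAbove j)) + X j)

lemma van_of_chart {p : Fin 4 → ℚ} {k : Fin 4} (hk : p k ≠ 0) {m d : ℕ}
    {F : MvPolynomial (Fin 4) ℚ} (hF : F.IsHomogeneous d)
    (h : Van m (aeval (chart p k) F) 0) : Van m F p := by
  induction m generalizing F d with
  | zero => trivial
  | succ m ih =>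
    have hd : ∀ (F : MvPolynomial (Fin 4) ℚ) (j : Fin 3), pderiv j (aeval (chart p k) F) =
        aeval (chart p k) (pderiv (k.succAbove j) F) := by
      intro F j
      rw [pderiv_aeval, Fin.sum_univ_succAbove _ k]
      simp only [chart, Fin.insertNth_apply_same, pderiv_C, zero_mul, Fin.insertNth_apply_succAbove,
        map_add, zero_add, pderiv_X]
      rw [Finset.sum_eq_single j]
      · simp
      · intro b _ hb
        simp [hb]
      · simp
    have hsucc : ∀ j : Fin 3, Van m (aeval (chart p k) (pderiv (k.succAbove j) F)) 0 := fun j => by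
      rw [← hd]; exact h.2 j
    refine ⟨?_, fun i => ih (hF.pderiv) ?_⟩
    · have h1 := h.1
      rw [← MvPolynomial.coe_aeval_eq_eval] at h1 ⊢
      have : ((aeval (0 : Fin 3 → ℚ)).comp (aeval (chart p k))) = aeval p := by
        apply MvPolynomial.algHom_ext
        intro i
        rcases Fin.eq_self_or_eq_succAbove k i with rfl | ⟨j, rfl⟩
        · simp [chart]
        · simp [chart]
      rw [← this]
      exact h1
    · rcases Fin.eq_self_or_eq_succAbove k i with rfl | ⟨j, rfl⟩
      · have he := congrArg (aeval (chart p i)) hF.sum_X_mul_pderiv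
        rw [map_sum, Fin.sum_univ_succAbove _ i] at he
        simp only [map_mul, aeval_X, map_nsmul] at he
        have he' : aeval (chart p i) (pderiv i F) = (p i)⁻¹ • ((d : ℚ) • aeval (chart p i) F +
            ∑ j : Fin 3, (-1 : ℚ) • (chart p i (i.succAbove j) *
              aeval (chart p i) (pderiv (i.succAbove j) F))) := by
          rw [← Finset.smul_sum, Nat.cast_smul_eq_nsmul, ← he]
          simp only [chart, Fin.insertNth_apply_same, C_mul']
          rw [neg_one_smul, add_neg_cancel_right, smul_smul, inv_mul_cancel₀ hk, one_smul]
        rw [he']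
        exact ((h.pred.smul _).add (Van.sum _ _ fun j _ => ((hsucc j).mul _).smul _)).smul _
      · exact hsucc j

lemma Van.iter {σ : Type} {m n : ℕ} {G : MvPolynomial σ ℚ} {q : σ → ℚ} (i : σ)
    (h : Van (m + n) G q) : Van m ((pderiv i)^[n] G) q := by
  induction n generalizing G with
  | zero => exact h
  | succ n ih =>
    rw [Function.iterate_succ_apply]
    exact ih (h.2 i)

end Glue
namespace Glue
open MvPolynomial

/-- the `j`-th special point -/
noncomputable def qpt (j : ℕ) : Fin 3 → ℚ :=
  ![((points.getD j (0, 0, 0)).1 : ℚ), ((points.getD j (0, 0, 0)).2.1 : ℚ),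
    ((points.getD j (0, 0, 0)).2.2 : ℚ)]

lemma points_nodup : points.Nodup := by decide +kernel

lemma qpt_inj {i j : ℕ} (hi : i < 22) (hj : j < 22) (h : qpt i = qpt j) : i = j := by
  have h0 := congrFun h 0
  have h1 := congrFun h 1
  have h2 := congrFun h 2
  simp only [qpt, Matrix.cons_val_zero, Matrix.cons_val_one, Matrix.cons_val, Nat.cast_inj]
    at h0 h1 h2
  have he : points.getD i (0, 0, 0) = points.getD j (0, 0, 0) := Prod.ext h0 (Prod.ext h1 h2)
  rw [List.getD_eq_getElem _ _ (by rw [points_length]; exact hi),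
    List.getD_eq_getElem _ _ (by rw [points_length]; exact hj)] at he
  exact (points_nodup.getElem_inj_iff).1 he

/-- exponent vector of a triple -/
noncomputable def expo (α : ℕ × ℕ × ℕ) : Fin 3 →₀ ℕ :=
  Finsupp.equivFunOnFinite.symm ![α.1, α.2.1, α.2.2]

lemma expo_inj {α β : ℕ × ℕ × ℕ} (h : expo α = expo β) : α = β := by
  have h := Finsupp.equivFunOnFinite.symm.injective h
  have h0 := congrFun h 0
  have h1 := congrFun h 1
  have h2 := congrFun h 2
  exact Prod.ext h0 (Prod.ext h1 h2)

lemma iter_pderiv_monomial (i : Fin 3) (n : ℕ) (s : Fin 3 →₀ ℕ) (c : ℚ) :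
    (pderiv i)^[n] (monomial s c) =
      monomial (s - Finsupp.single i n) (c * ((s i).descFactorial n : ℚ)) := by
  induction n with
  | zero => simp
  | succ n ih =>
    rw [Function.iterate_succ_apply', ih, pderiv_monomial]
    congr 1
    · rw [tsub_tsub, ← Finsupp.single_add]
    · rw [Nat.descFactorial_succ]
      simp
      ring

/-- iterated derivative -/
noncomputable def D3 (ν : ℕ × ℕ × ℕ) : MvPolynomial (Fin 3) ℚ →ₗ[ℚ] MvPolynomial (Fin 3) ℚ :=
  ((pderiv 2).toLinearMap ^ ν.2.2) ∘ₗ ((pderiv 1).toLinearMap ^ ν.2.1) ∘ₗ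
    ((pderiv 0).toLinearMap ^ ν.1)

lemma D3_apply (ν : ℕ × ℕ × ℕ) (G : MvPolynomial (Fin 3) ℚ) :
    D3 ν G = (pderiv 2)^[ν.2.2] ((pderiv 1)^[ν.2.1] ((pderiv 0)^[ν.1] G)) := by
  simp only [D3, LinearMap.comp_apply, Module.End.pow_apply]
  rfl

lemma D3_eval (x ν α : ℕ × ℕ × ℕ) (c : ℚ) :
    eval (![(x.1 : ℚ), (x.2.1 : ℚ), (x.2.2 : ℚ)]) (D3 ν (monomial (expo α) c)) =
      (entry (x, ν) α : ℚ) * c := by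
  rw [D3_apply, iter_pderiv_monomial, iter_pderiv_monomial, iter_pderiv_monomial, eval_monomial]
  have h0 : expo α 0 = α.1 := rfl
  have h1 : expo α 1 = α.2.1 := rfl
  have h2 : expo α 2 = α.2.2 := rfl
  rw [Finsupp.prod_fintype _ _ (by simp), Fin.prod_univ_three]
  simp [Finsupp.single_apply, h0, h1, h2, entry]
  ring

lemma Van.D3 {m : ℕ} {G : MvPolynomial (Fin 3) ℚ} {q : Fin 3 → ℚ} {ν : ℕ × ℕ × ℕ}
    (h : Van m G q) (hν : ν.1 + ν.2.1 + ν.2.2 < m) : eval q (D3 ν G) = 0 := by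
  obtain ⟨k, rfl⟩ : ∃ k, m = (k + 1) + ν.2.2 + ν.2.1 + ν.1 :=
    ⟨m - (ν.1 + ν.2.1 + ν.2.2) - 1, by omega⟩
  rw [D3_apply]
  exact (((h.iter 0).iter 1).iter 2).1

theorem key (a b : ℕ) (hab : 2 * a + b = 22) (G : MvPolynomial (Fin 3) ℚ)
    (hG : ∀ μ : Fin 3 →₀ ℕ, 10 ≤ μ.degree → coeff μ G = 0)
    (hv : ∀ j < a + b, Van (if j < a then 4 else 3) G (qpt j)) : G = 0 := by
  have hinj : Set.InjOn expo (mons.toFinset : Set (ℕ × ℕ × ℕ)) := fun _ _ _ _ h => expo_inj h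
  have hmem : ∀ μ : Fin 3 →₀ ℕ, μ.degree < 10 → ∃ α ∈ mons, expo α = μ := by
    intro μ hμ
    refine ⟨(μ 0, μ 1, μ 2), mem_mons _ ?_, ?_⟩
    · rw [Finsupp.degree_eq_sum, Fin.sum_univ_three] at hμ
      simp only
      omega
    · ext i
      fin_cases i <;> rfl
  have hsum : G = ∑ α ∈ mons.toFinset, monomial (expo α) (coeff (expo α) G) := by
    rw [← Finset.sum_image (f := fun μ => monomial μ (coeff μ G)) hinj]
    conv_lhs => rw [MvPolynomial.as_sum G]
    apply Finset.sum_subset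
    · intro μ hμ
      rw [Finset.mem_image]
      by_cases hd : μ.degree < 10
      · obtain ⟨α, h1, h2⟩ := hmem μ hd
        exact ⟨α, by simpa using h1, h2⟩
      · exact absurd (hG μ (by omega)) (mem_support_iff.1 hμ)
    · intro μ _ hμ
      rw [notMem_support_iff.1 hμ, monomial_zero]
  have hcore := core a b hab (fun α => coeff (expo α) G) ?_
  · ext μ
    rw [coeff_zero]
    by_cases hd : μ.degree < 10
    · obtain ⟨α, h1, rfl⟩ := hmem μ hd
      exact hcore α h1
    · exact hG μ (by omega)
  · intro s hs
    obtain ⟨j, hj, hjab, h1, h2⟩ := spec_mem _ _ _ _ hs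
    have h3 := (hv j hjab).D3 h2
    rw [hsum, map_sum, map_sum] at h3
    have hq : qpt j = ![(s.1.1 : ℚ), (s.1.2.1 : ℚ), (s.1.2.2 : ℚ)] := by
      rw [h1, qpt, List.getD_eq_getElem _ _ hj]
    simp only [hq, D3_eval] at h3
    rw [List.sum_toFinset _ mons_nodup] at h3
    exact h3

end Glue
namespace Glue
open MvPolynomial

/-- exponents of degree `d` in 4 variables -/
noncomputable def Sset (d : ℕ) : Finset (Fin 4 →₀ ℕ) := Finset.finsuppAntidiag Finset.univ d

lemma Sset_card (d : ℕ) : (Sset d).card = (d + 3).choose 3 := by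
  rw [Sset, Finset.card_finsuppAntidiag_nat_eq_choose]
  simp
  rw [← Nat.choose_symm_add]
  congr 1
  omega

/-- exponents of degree less than `m` in 3 variables -/
noncomputable def Tset (m : ℕ) : Finset (Fin 3 →₀ ℕ) :=
  (Finset.range m).biUnion fun k => Finset.finsuppAntidiag Finset.univ k

lemma Tset_card (m : ℕ) : (Tset m).card ≤ (m + 2).choose 3 := by
  refine Finset.card_biUnion_le.trans ?_
  have h : ∀ k, (Finset.finsuppAntidiag (Finset.univ : Finset (Fin 3)) k).card =
      (k + 2).choose 2 := by
    intro k
    rw [Finset.card_finsuppAntidiag_nat_eq_choose]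
    simp
    rw [← Nat.choose_symm_add]
    congr 1
    omega
  simp_rw [h]
  induction m with
  | zero => simp
  | succ m ih =>
    rw [Finset.sum_range_succ, show m + 1 + 2 = (m + 2) + 1 by ring, Nat.choose_succ_succ' (m + 2) 2,
      show 2 + 1 = 3 from rfl]
    omega

lemma mem_Tset (m : ℕ) (μ : Fin 3 →₀ ℕ) : μ ∈ Tset m ↔ μ.degree < m := by
  simp [Tset, Finset.mem_finsuppAntidiag, Finsupp.degree_eq_sum]

lemma mem_Sset (d : ℕ) (μ : Fin 4 →₀ ℕ) : μ ∈ Sset d ↔ μ.degree = d := by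
  simp [Sset, Finset.mem_finsuppAntidiag, Finsupp.degree_eq_sum]

instance finite_hom (d : ℕ) : Module.Finite ℚ (homogeneousSubmodule (Fin 4) ℚ d) :=
  Module.Finite.iff_fg.2 (homogeneousSubmodule_fg _ _ _)

instance finite_sys (d : ℕ) (ms : List ℕ) (pts : Fin ms.length → Fin 4 → ℚ) :
    Module.Finite ℚ (systemSpace d ms pts) :=
  Submodule.finiteDimensional_of_le (S₂ := homogeneousSubmodule (Fin 4) ℚ d) inf_le_left

/-- the polynomial with given coefficients -/
noncomputable def polyOf (d : ℕ) : (Sset d → ℚ) →ₗ[ℚ] MvPolynomial (Fin 4) ℚ :=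
  LinearMap.lsum ℚ (fun _ => ℚ) ℚ fun μ => monomial μ.1

lemma coeff_polyOf (d : ℕ) (c : Sset d → ℚ) (μ : Sset d) : coeff μ.1 (polyOf d c) = c μ := by
  classical
  simp [polyOf, coeff_sum, coeff_monomial]

lemma polyOf_hom (d : ℕ) (c : Sset d → ℚ) : (polyOf d c).IsHomogeneous d := by
  simp only [polyOf, LinearMap.lsum_apply, LinearMap.sum_apply, LinearMap.comp_apply]
  refine IsHomogeneous.sum _ _ _ fun μ _ => ?_
  exact isHomogeneous_monomial _ ((mem_Sset d μ.1).1 μ.2)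

lemma mem_systemSpace (d : ℕ) (ms : List ℕ) (pts : Fin ms.length → Fin 4 → ℚ)
    (F : MvPolynomial (Fin 4) ℚ) : F ∈ systemSpace d ms pts ↔
      F.IsHomogeneous d ∧ ∀ i, Van (ms.get i) F (pts i) := by
  simp [systemSpace, mem_vanishingSpace]

theorem lower_bound (d : ℕ) (ms : List ℕ) (pts : Fin ms.length → Fin 4 → ℚ)
    (h0 : ∀ i, pts i ≠ 0) :
    max (vdim d ms + 1) 0 ≤ (Module.finrank ℚ (systemSpace d ms pts) : ℤ) := by
  refine max_le ?_ (by positivity)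
  have hk : ∀ i, ∃ k, pts i k ≠ 0 := fun i => by
    by_contra hh
    push Not at hh
    exact h0 i (funext hh)
  choose k hk using hk
  let Φ : (Sset d → ℚ) →ₗ[ℚ] ((x : (i : Fin ms.length) × Tset (ms.get i)) → ℚ) :=
    LinearMap.pi fun x => (lcoeff ℚ x.2.1) ∘ₗ
      (aeval (chart (pts x.1) (k x.1))).toLinearMap ∘ₗ polyOf d
  have hΦ : ∀ c, c ∈ LinearMap.ker Φ → polyOf d c ∈ systemSpace d ms pts := by
    intro c hc
    rw [mem_systemSpace]
    refine ⟨polyOf_hom d c, fun i => ?_⟩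
    refine van_of_chart (hk i) (polyOf_hom d c) (Van.of_coeff fun μ hμ => ?_)
    exact congrFun hc ⟨i, ⟨μ, (mem_Tset _ _).2 hμ⟩⟩
  have h1 : Module.finrank ℚ (LinearMap.ker Φ) ≤ Module.finrank ℚ (systemSpace d ms pts) := by
    refine LinearMap.finrank_le_finrank_of_injective (f := (polyOf d).restrict hΦ) ?_
    intro c c' hcc
    have hcc := congrArg Subtype.val hcc
    apply Subtype.ext
    funext μ
    rw [← coeff_polyOf d c.1, ← coeff_polyOf d c'.1]
    exact congrArg _ hcc
  have h2 := Φ.finrank_range_add_finrank_ker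
  have h3 := Submodule.finrank_le (LinearMap.range Φ)
  rw [Module.finrank_fintype_fun_eq_card, Fintype.card_coe, Sset_card] at h2
  rw [Module.finrank_fintype_fun_eq_card, Fintype.card_sigma] at h3
  have h4 : ∑ i : Fin ms.length, Fintype.card (Tset (ms.get i)) ≤
      (ms.map fun m => (m + 2).choose 3).sum := by
    rw [← Fin.sum_univ_fun_getElem]
    refine Finset.sum_le_sum fun i _ => ?_
    rw [Fintype.card_coe]
    exact Tset_card _
  have h5 : ((ms.map fun m => ((m + 2).choose 3 : ℤ)).sum) =
    (((ms.map fun m => (m + 2).choose 3).sum : ℕ) : ℤ) := by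
    rw [Nat.cast_list_sum, List.map_map]; rfl
  rw [vdim, h5]
  omega

end Glue
namespace Glue
open MvPolynomial Topology

/-- kernels can only shrink under small perturbations -/
theorem semicont {U ι : Type} [AddCommGroup U] [Module ℚ U] [Module.Finite ℚ U] [Fintype ι]
    (Λ : ℚ → U →ₗ[ℚ] (ι → ℚ)) (hΛ : ∀ u, Continuous fun t => Λ t u) :
    ∀ᶠ t in 𝓝 (0 : ℚ), Module.finrank ℚ (LinearMap.ker (Λ t)) ≤
      Module.finrank ℚ (LinearMap.ker (Λ 0)) := by
  obtain ⟨W, hW⟩ := Submodule.exists_isCompl (LinearMap.ker (Λ 0))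
  have hinj : LinearMap.ker ((Λ 0) ∘ₗ W.subtype) = ⊥ := by
    rw [LinearMap.ker_eq_bot']
    intro w hw
    have : (w : U) ∈ LinearMap.ker (Λ 0) ⊓ W := ⟨hw, w.2⟩
    rw [hW.inf_eq_bot] at this
    exact Subtype.ext this
  obtain ⟨R, hR⟩ := LinearMap.exists_leftInverse_of_injective _ hinj
  let f : ℚ → (W →ₗ[ℚ] W) := fun t => R ∘ₗ (Λ t) ∘ₗ W.subtype
  let b := Module.finBasis ℚ W
  have hdet : Continuous fun t => (LinearMap.toMatrix b b (f t)).det := by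
    apply Continuous.matrix_det
    refine continuous_matrix fun i j => ?_
    simp only [LinearMap.toMatrix_apply, f, LinearMap.comp_apply]
    have : Continuous ((b.coord i) ∘ₗ R) := LinearMap.continuous_on_pi _
    exact this.comp (hΛ _)
  have h0 : (LinearMap.toMatrix b b (f 0)).det ≠ 0 := by
    rw [show f 0 = LinearMap.id from hR, LinearMap.toMatrix_id, Matrix.det_one]
    exact one_ne_zero
  filter_upwards [hdet.continuousAt.eventually_ne h0] with t ht
  have hdisj : Disjoint (LinearMap.ker (Λ t)) W := by
    rw [Submodule.disjoint_def]
    intro x hx hxW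
    by_contra hne
    apply ht
    rw [LinearMap.det_toMatrix]
    by_contra hd
    have : IsUnit (LinearMap.det (f t)) := isUnit_iff_ne_zero.2 hd
    have hi := ((Module.End.isUnit_iff _).1 ((LinearMap.isUnit_iff_isUnit_det _).2 this)).1
    have hx0 : f t ⟨x, hxW⟩ = 0 := by
      simp only [f, LinearMap.comp_apply, Submodule.subtype_apply]
      rw [LinearMap.mem_ker.1 hx, map_zero]
    have := hi (a₁ := ⟨x, hxW⟩) (a₂ := 0) (by rw [map_zero]; exact hx0)
    exact hne (congrArg Subtype.val this)
  have h1 := Submodule.finrank_add_finrank_le_of_disjoint hdisj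
  have h2 := Submodule.finrank_add_eq_of_isCompl hW
  omega

/-- polynomials of degree at most 9 -/
noncomputable def Aset : Submodule ℚ (MvPolynomial (Fin 3) ℚ) where
  carrier := {G | ∀ μ : Fin 3 →₀ ℕ, 10 ≤ μ.degree → coeff μ G = 0}
  add_mem' := fun {F G} hF hG μ hμ => by rw [coeff_add, hF μ hμ, hG μ hμ, add_zero]
  zero_mem' := fun μ _ => coeff_zero μ
  smul_mem' := fun c F hF μ hμ => by rw [coeff_smul, hF μ hμ, smul_zero]

/-- polynomials with the prescribed vanishing -/
noncomputable def Zset (a b : ℕ) : Submodule ℚ (MvPolynomial (Fin 3) ℚ) where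
  carrier := {G | ∀ j < a + b, Van (if j < a then 4 else 3) G (qpt j)}
  add_mem' := fun {F G} hF hG j hj => (hF j hj).add (hG j hj)
  zero_mem' := fun j _ => Van.zero _ _
  smul_mem' := fun c F hF j hj => (hF j hj).smul c

/-- interpolation projection -/
lemma exists_proj (a b : ℕ) (hab : 2 * a + b = 22) :
    ∃ π : MvPolynomial (Fin 3) ℚ →ₗ[ℚ] MvPolynomial (Fin 3) ℚ,
      (∀ G ∈ Aset, π G = G) ∧ ∀ G ∈ Zset a b, π G = 0 := by
  have hd : Disjoint Aset (Zset a b) := by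
    rw [Submodule.disjoint_def]
    intro G hA hZ
    exact key a b hab G hA hZ
  obtain ⟨A', hA', hc⟩ := hd.exists_isCompl
  refine ⟨A'.projection _ hc, fun G hG => ?_, fun G hG => ?_⟩
  · exact Submodule.projection_apply_of_mem_left hc (hA' hG)
  · exact (Submodule.projection_apply_eq_zero_iff hc).2 hG

lemma coeff_scale (t : ℚ) (G : MvPolynomial (Fin 3) ℚ) (μ : Fin 3 →₀ ℕ) :
    coeff μ (aeval (fun i => t • (X i : MvPolynomial (Fin 3) ℚ)) G) = t ^ μ.degree * coeff μ G := by
  classical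
  induction G using MvPolynomial.induction_on' with
  | add p q hp hq => rw [map_add, coeff_add, hp, hq, coeff_add, mul_add]
  | monomial s c =>
    have : aeval (fun i => t • (X i : MvPolynomial (Fin 3) ℚ)) (monomial s c) =
        monomial s (t ^ s.degree * c) := by
      rw [aeval_monomial, Finsupp.prod_fintype _ _ (by simp)]
      simp_rw [smul_pow]
      rw [Finset.prod_smul, Finset.prod_pow_eq_pow_sum, ← Finsupp.degree_eq_sum, algebraMap_eq,
        mul_smul_comm, ← Finsupp.prod_fintype s (fun i n => (X i : MvPolynomial (Fin 3) ℚ) ^ n)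
          (by simp), ← monomial_eq, smul_monomial, smul_eq_mul]
    rw [this, coeff_monomial, coeff_monomial]
    split_ifs with h
    · rw [h]
    · simp

lemma chart_deg (p : Fin 4 → ℚ) (k : Fin 4) (i : Fin 4) : (chart p k i).totalDegree ≤ 1 := by
  rcases Fin.eq_self_or_eq_succAbove k i with rfl | ⟨j, rfl⟩
  · simp [chart]
  · simp only [chart, Fin.insertNth_apply_succAbove]
    refine (totalDegree_add _ _).trans ?_
    simp

lemma aeval_deg (f : Fin 4 → MvPolynomial (Fin 3) ℚ) (hf : ∀ i, (f i).totalDegree ≤ 1) (d : ℕ)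
    (F : MvPolynomial (Fin 4) ℚ) (hF : F.IsHomogeneous d) : (aeval f F).totalDegree ≤ d := by
  rw [MvPolynomial.as_sum F, map_sum]
  refine totalDegree_finsetSum_le fun s hs => ?_
  rw [aeval_monomial, Finsupp.prod_fintype _ _ (by simp)]
  refine (totalDegree_mul _ _).trans ?_
  rw [algebraMap_eq, totalDegree_C, zero_add]
  refine (totalDegree_finsetProd _ _).trans ?_
  have h1 : s.degree = d := by
    have := hF (mem_support_iff.1 hs)
    rw [← this, Finsupp.degree_eq_weight_one]
    rfl
  rw [← h1, Finsupp.degree_eq_sum]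
  refine Finset.sum_le_sum fun i _ => ?_
  exact (totalDegree_pow _ _).trans (by nlinarith [hf i])

/-- the deformed conditions -/
noncomputable def lam (π : MvPolynomial (Fin 3) ℚ →ₗ[ℚ] MvPolynomial (Fin 3) ℚ) (p : Fin 4 → ℚ)
    (k : Fin 4) (d : ℕ) (t : ℚ) : MvPolynomial (Fin 4) ℚ →ₗ[ℚ] (Tset 10 → ℚ) :=
  LinearMap.pi fun μ => ∑ n ∈ Finset.range (d + 10),
    (if μ.1.degree ≤ n then t ^ (n - μ.1.degree) else 0) •
      ((lcoeff ℚ μ.1) ∘ₗ π ∘ₗ (homogeneousComponent n) ∘ₗ (aeval (chart p k)).toLinearMap)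

lemma lam_apply (π : MvPolynomial (Fin 3) ℚ →ₗ[ℚ] MvPolynomial (Fin 3) ℚ) (p : Fin 4 → ℚ)
    (k : Fin 4) (d : ℕ) (t : ℚ) (F : MvPolynomial (Fin 4) ℚ) (μ : Tset 10) :
    lam π p k d t F μ = ∑ n ∈ Finset.range (d + 10),
      (if μ.1.degree ≤ n then t ^ (n - μ.1.degree) else 0) *
        coeff μ.1 (π (homogeneousComponent n (aeval (chart p k) F))) := by
  simp only [lam, LinearMap.pi_apply, LinearMap.sum_apply, LinearMap.smul_apply,
    LinearMap.comp_apply, smul_eq_mul]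
  rfl

lemma comp_mem_Aset {n : ℕ} (hn : n < 10) (H : MvPolynomial (Fin 3) ℚ) :
    homogeneousComponent n H ∈ Aset := by
  intro μ hμ
  rw [coeff_homogeneousComponent, if_neg (by omega)]

lemma lam_zero (π : MvPolynomial (Fin 3) ℚ →ₗ[ℚ] MvPolynomial (Fin 3) ℚ)
    (hπ : ∀ G ∈ Aset, π G = G) (p : Fin 4 → ℚ)
    (k : Fin 4) (d : ℕ) (F : MvPolynomial (Fin 4) ℚ) (μ : Tset 10) :
    lam π p k d 0 F μ = coeff μ.1 (aeval (chart p k) F) := by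
  have hμ := (mem_Tset _ _).1 μ.2
  rw [lam_apply, Finset.sum_eq_single μ.1.degree]
  · rw [hπ _ (comp_mem_Aset hμ _), coeff_homogeneousComponent]
    simp
  · intro n _ hn
    split_ifs with h
    · rw [zero_pow (by omega), zero_mul]
    · rw [zero_mul]
  · intro h
    exact absurd (Finset.mem_range.2 (by omega)) h

lemma lam_ne (π : MvPolynomial (Fin 3) ℚ →ₗ[ℚ] MvPolynomial (Fin 3) ℚ)
    (hπ : ∀ G ∈ Aset, π G = G) {a b : ℕ} (hπ' : ∀ G ∈ Zset a b, π G = 0) (p : Fin 4 → ℚ)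
    (k : Fin 4) (d : ℕ) (t : ℚ) (ht : t ≠ 0) (F : MvPolynomial (Fin 4) ℚ) (hF : F.IsHomogeneous d)
    (hv : ∀ j < a + b, Van (if j < a then 4 else 3) F
      (p + t • (k.insertNth 0 (qpt j) : Fin 4 → ℚ))) :
    lam π p k d t F = 0 := by
  have hZ : aeval (fun i => t • (X i : MvPolynomial (Fin 3) ℚ)) (aeval (chart p k) F) ∈
      Zset a b := by
    intro j hj
    have h1 := (hv j hj).comp (chart p k) (t • qpt j) ?_
    · refine h1.comp _ _ fun i => ?_
      simp [smul_eval]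
    · intro i
      rcases Fin.eq_self_or_eq_succAbove k i with rfl | ⟨j, rfl⟩
      · simp [chart]
      · simp [chart]
  have hs : aeval (fun i => t • (X i : MvPolynomial (Fin 3) ℚ)) (aeval (chart p k) F) =
      ∑ n ∈ Finset.range (d + 10), t ^ n • homogeneousComponent n (aeval (chart p k) F) := by
    ext μ
    rw [coeff_scale, coeff_sum]
    simp only [coeff_smul, coeff_homogeneousComponent, smul_eq_mul, mul_ite, mul_zero]
    rw [Finset.sum_ite_eq]
    split_ifs with h
    · rfl
    · rw [Finset.mem_range] at h
      rw [coeff_eq_zero_of_totalDegree_lt, mul_zero]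
      refine (aeval_deg _ (chart_deg p k) d F hF).trans_lt ?_
      rw [Finsupp.degree_apply] at h
      omega
  have h0 := hπ' _ hZ
  rw [hs, map_sum] at h0
  funext μ
  have hμ := (mem_Tset _ _).1 μ.2
  have h1 := congrArg (coeff μ.1) h0
  rw [coeff_sum, coeff_zero] at h1
  have h2 : t ^ μ.1.degree * lam π p k d t F μ = 0 := by
    rw [← h1, lam_apply, Finset.mul_sum]
    refine Finset.sum_congr rfl fun n _ => ?_
    rw [map_smul, coeff_smul, smul_eq_mul]
    split_ifs with h
    · rw [← mul_assoc, ← pow_add]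
      congr 2
      omega
    · rw [hπ _ (comp_mem_Aset (by omega) _), coeff_homogeneousComponent, if_neg (by omega)]
      simp
  rcases mul_eq_zero.1 h2 with h | h
  · exact absurd h (pow_ne_zero _ ht)
  · exact h

theorem upper_bound (a b : ℕ) (hab : 2 * a + b = 22) (d : ℕ) (U : Submodule ℚ (MvPolynomial (Fin 4) ℚ))
    (hU : ∀ F ∈ U, F.IsHomogeneous d) (p : Fin 4 → ℚ) (k : Fin 4) (hk : p k ≠ 0) :
    ∀ᶠ t in 𝓝 (0 : ℚ), t ≠ 0 → ∀ Y : Submodule ℚ (MvPolynomial (Fin 4) ℚ), Y ≤ U →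
      (∀ F ∈ Y, ∀ j < a + b, Van (if j < a then 4 else 3) F
        (p + t • (k.insertNth 0 (qpt j) : Fin 4 → ℚ))) →
      ∀ Y' : Submodule ℚ (MvPolynomial (Fin 4) ℚ), (∀ F ∈ U, Van 10 F p → F ∈ Y') → Y' ≤ U → 
      Module.finrank ℚ Y ≤ Module.finrank ℚ Y' := by
  obtain ⟨π, hπ, hπ'⟩ := exists_proj a b hab
  have hfin : Module.Finite ℚ U :=
    Submodule.finiteDimensional_of_le (S₂ := homogeneousSubmodule (Fin 4) ℚ d) hU
  have := semicont (U := U) (fun t => (lam π p k d t) ∘ₗ U.subtype) ?_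
  · filter_upwards [this] with t ht ht0 Y hYU hY Y' hY' hY'U
    have hfin' : Module.Finite ℚ Y' := Submodule.finiteDimensional_of_le hY'U
    refine le_trans (le_trans ?_ ht) ?_
    · refine LinearMap.finrank_le_finrank_of_injective (f := (Submodule.inclusion hYU).codRestrict _
        fun F => ?_) ?_
      · rw [LinearMap.mem_ker]
        exact lam_ne π hπ hπ' p k d t ht0 F.1 (hU _ (hYU F.2)) (hY F.1 F.2)
      · intro x y hxy
        exact Subtype.ext (congrArg (fun z => (z.1 : MvPolynomial (Fin 4) ℚ)) hxy)
    · refine LinearMap.finrank_le_finrank_of_injective (f := (U.subtype ∘ₗ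
        Submodule.subtype _).codRestrict Y' fun F => ?_) ?_
      · refine hY' _ F.1.2 (van_of_chart hk (hU _ F.1.2) (Van.of_coeff fun μ hμ => ?_))
        have hF := congrFun (LinearMap.mem_ker.1 F.2) ⟨μ, (mem_Tset _ _).2 hμ⟩
        have h2 := lam_zero π hπ p k d F.1.1 ⟨μ, (mem_Tset _ _).2 hμ⟩
        exact h2.symm.trans hF
      · intro x y hxy
        exact Subtype.ext (Subtype.ext (congrArg (fun z => (z.1 : MvPolynomial (Fin 4) ℚ)) hxy))
  · intro u
    refine continuous_pi fun μ => ?_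
    simp only [LinearMap.comp_apply, lam_apply]
    refine continuous_finsetSum _ fun n _ => Continuous.mul ?_ continuous_const
    split_ifs
    · fun_prop
    · exact continuous_const

end Glue
namespace Glue
open MvPolynomial Topology

lemma indep_of_minor {u v : Fin 4 → ℚ} {i j : Fin 4} (h : u i * v j - u j * v i ≠ 0) :
    LinearIndependent ℚ ![u, v] := by
  rw [LinearIndependent.pair_iff]
  intro s t hst
  have hi := congrFun hst i
  have hj := congrFun hst j
  simp only [Pi.add_apply, Pi.smul_apply, smul_eq_mul, Pi.zero_apply] at hi hj
  constructor
  · have : s * (u i * v j - u j * v i) = 0 := by linear_combination v j * hi - v i * hj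
    exact (mul_eq_zero.1 this).resolve_right h
  · have : t * (u i * v j - u j * v i) = 0 := by linear_combination u i * hj - u j * hi
    exact (mul_eq_zero.1 this).resolve_right h

lemma minor_of_indep {u v : Fin 4 → ℚ} (hv : v ≠ 0) (h : LinearIndependent ℚ ![u, v]) :
    ∃ i j, u i * v j - u j * v i ≠ 0 := by
  by_contra hh
  push Not at hh
  obtain ⟨j, hj⟩ : ∃ j, v j ≠ 0 := by
    by_contra hh
    push Not at hh
    exact hv (funext hh)
  rw [LinearIndependent.pair_iff] at h
  refine hj (h (v j) (-u j) ?_).1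
  funext i
  simp only [Pi.add_apply, Pi.smul_apply, smul_eq_mul, Pi.zero_apply]
  linear_combination hh i j

lemma old_new {u p q : Fin 4 → ℚ} (hp : p ≠ 0) (h : LinearIndependent ℚ ![u, p]) :
    ∀ᶠ t in 𝓝 (0 : ℚ), LinearIndependent ℚ ![u, p + t • q] := by
  obtain ⟨i, j, hij⟩ := minor_of_indep hp h
  have hc : Continuous fun t : ℚ => u i * (p + t • q) j - u j * (p + t • q) i := by
    simp only [Pi.add_apply, Pi.smul_apply, smul_eq_mul]
    fun_prop
  have h0 : (fun t : ℚ => u i * (p + t • q) j - u j * (p + t • q) i) 0 ≠ 0 := by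
    simpa using hij
  filter_upwards [hc.continuousAt.eventually_ne h0] with t ht
  exact indep_of_minor ht

lemma new_new {p : Fin 4 → ℚ} {k : Fin 4} (hk : p k ≠ 0) {t : ℚ} (ht : t ≠ 0) {q q' : Fin 3 → ℚ}
    (h : q ≠ q') : LinearIndependent ℚ ![p + t • (k.insertNth 0 q : Fin 4 → ℚ),
      p + t • (k.insertNth 0 q' : Fin 4 → ℚ)] := by
  obtain ⟨l, hl⟩ := Function.ne_iff.1 h
  apply indep_of_minor (i := k) (j := k.succAbove l)
  simp only [Pi.add_apply, Pi.smul_apply, smul_eq_mul, Fin.insertNth_apply_same,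
    Fin.insertNth_apply_succAbove]
  have : (p k + t * 0) * (p (k.succAbove l) + t * q' l) -
      (p (k.succAbove l) + t * q l) * (p k + t * 0) = p k * (t * (q' l - q l)) := by ring
  rw [this]
  exact mul_ne_zero hk (mul_ne_zero ht (sub_ne_zero.2 (Ne.symm hl)))

lemma vdim_eq (d : ℕ) (ms : List ℕ) (a b : ℕ) (hab : 2 * a + b = 22) :
    vdim d (ms ++ List.replicate a 4 ++ List.replicate b 3) = vdim d (ms ++ [10]) := by
  simp only [vdim, List.map_append, List.sum_append, List.map_replicate, List.sum_replicate]
  have h1 : ((4 + 2 : ℕ).choose 3 : ℤ) = 20 := by decide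
  have h2 : ((3 + 2 : ℕ).choose 3 : ℤ) = 10 := by decide
  have h3 : ((10 + 2 : ℕ).choose 3 : ℤ) = 220 := by decide +kernel
  simp only [List.map_cons, List.map_nil, List.sum_cons, List.sum_nil, h1, h2, h3, nsmul_eq_mul]
  omega

end Glue

theorem glueing_to_ten (d : ℕ) (ms : List ℕ) (a b : ℕ) (hab : 2 * a + b = 22)
    (h : nonSpecial d (ms ++ [10])) :
    nonSpecial d (ms ++ List.replicate a 4 ++ List.replicate b 3) := by
  obtain ⟨pts, hne, hind, hdim⟩ := h
  have hlen : (ms ++ [10]).length = ms.length + 1 := by simp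
  have hlen' : (ms ++ List.replicate a 4 ++ List.replicate b 3).length = ms.length + (a + b) := by
    simp [add_assoc]
  let old : Fin ms.length → Fin 4 → ℚ := fun i => pts ⟨i.1, by omega⟩
  let p : Fin 4 → ℚ := pts ⟨ms.length, by omega⟩
  have hp : p ≠ 0 := hne _
  obtain ⟨k, hk⟩ : ∃ k, p k ≠ 0 := Function.ne_iff.1 hp
  have hop : ∀ i, LinearIndependent ℚ ![old i, p] := fun i =>
    hind _ _ (by simp only [ne_eq, Fin.mk.injEq]; have := i.2; omega)
  have hU : ∀ F ∈ systemSpace d ms old, F.IsHomogeneous d := fun F hF =>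
    ((Glue.mem_systemSpace _ _ _ _).1 hF).1
  have e1 := Glue.upper_bound a b hab d (systemSpace d ms old) hU p k hk
  have e2 : ∀ᶠ t in nhds (0 : ℚ), ∀ (i : Fin ms.length) (j : Fin 22),
      LinearIndependent ℚ ![old i, p + t • (k.insertNth 0 (Glue.qpt j) : Fin 4 → ℚ)] := by
    rw [Filter.eventually_all]
    intro i
    rw [Filter.eventually_all]
    intro j
    exact Glue.old_new hp (hop i)
  obtain ⟨t, ⟨h1, h2⟩, ht⟩ := (((e1.and e2).filter_mono nhdsWithin_le_nhds).and
    (self_mem_nhdsWithin (a := (0 : ℚ)) (s := {0}ᶜ))).exists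
  have ht : t ≠ 0 := ht
  let new : Fin (ms ++ List.replicate a 4 ++ List.replicate b 3).length → Fin 4 → ℚ := fun i =>
    if hi : i.1 < ms.length then old ⟨i.1, hi⟩
    else p + t • (k.insertNth 0 (Glue.qpt (i.1 - ms.length)) : Fin 4 → ℚ)
  have hnew1 : ∀ i, ∀ hi : i.1 < ms.length, new i = old ⟨i.1, hi⟩ := fun i hi => dif_pos hi
  have hnew2 : ∀ i, ¬ i.1 < ms.length → new i =
    p + t • (k.insertNth 0 (Glue.qpt (i.1 - ms.length)) : Fin 4 → ℚ) := fun i hi => dif_neg hi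
  have hne' : ∀ i, new i ≠ 0 := by
    intro i
    by_cases hi : i.1 < ms.length
    · rw [hnew1 i hi]; exact hne _
    · rw [hnew2 i hi]
      intro h0
      apply hk
      simpa using congrFun h0 k
  refine ⟨new, hne', ?_, ?_⟩
  · intro i j hij
    have hi' := i.2
    have hj' := j.2
    have hij' : i.1 ≠ j.1 := fun h => hij (Fin.ext h)
    by_cases hi : i.1 < ms.length <;> by_cases hj : j.1 < ms.length
    · rw [hnew1 i hi, hnew1 j hj]
      exact hind _ _ (by simpa using hij')
    · rw [hnew1 i hi, hnew2 j hj]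
      exact h2 ⟨i.1, hi⟩ ⟨j.1 - ms.length, by omega⟩
    · rw [hnew2 i hi, hnew1 j hj, LinearIndependent.pair_symm_iff]
      exact h2 ⟨j.1, hj⟩ ⟨i.1 - ms.length, by omega⟩
    · rw [hnew2 i hi, hnew2 j hj]
      refine Glue.new_new hk ht fun hq => ?_
      have := Glue.qpt_inj (by omega) (by omega) hq
      omega
  · refine le_antisymm ?_ (Glue.lower_bound d _ new hne')
    rw [Glue.vdim_eq d ms a b hab, ← hdim, Nat.cast_le]
    refine h1 ht _ ?_ ?_ _ ?_ ?_
    · intro F hF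
      rw [Glue.mem_systemSpace] at hF ⊢
      refine ⟨hF.1, fun i => ?_⟩
      have := hF.2 ⟨i.1, by omega⟩
      rw [hnew1 _ i.2] at this
      simpa [List.getElem_append_left] using this
    · intro F hF j hj
      rw [Glue.mem_systemSpace] at hF
      have := hF.2 ⟨ms.length + j, by omega⟩
      rw [hnew2 _ (by simp)] at this
      convert this using 1
      · simp only [List.get_eq_getElem, List.append_assoc]
        rw [List.getElem_append_right (by omega)]
        split_ifs with hja
        · rw [List.getElem_append_left (by simp; omega)]
          simp
        · rw [List.getElem_append_right (by simp; omega)]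
          simp
      · simp
    · intro F hF hv
      rw [Glue.mem_systemSpace] at hF ⊢
      refine ⟨hF.1, fun i => ?_⟩
      by_cases hi : i.1 < ms.length
      · have := hF.2 ⟨i.1, hi⟩
        simpa [List.getElem_append_left, hi, old] using this
      · have hi' : i = ⟨ms.length, by omega⟩ := Fin.ext (by have := i.2; simp only; omega)
        rw [hi']
        simpa using hv
    · intro F hF
      rw [Glue.mem_systemSpace] at hF ⊢
      refine ⟨hF.1, fun i => ?_⟩
      have := hF.2 ⟨i.1, by omega⟩
      simpa [List.getElem_append_left, old] using this
end

section
/- For all non-negative integers a, b with 2a + b = 56, the system L_3(13; 4^{×a}, 3^{×b}) is non-special of virtual dimension −1; that is, there exist a + b pairwise linearly independent points in ℚ^4 \ {0} such that the only homogeneous polynomial of degree 13 in 4 variables over ℚ vanishing to order ≥ 4 at the first a points and ≥ 3 at the remaining b points is the zero polynomial, and indeed C(16,3) − 20a − 10b − 1 = 560 − 10(2a+b) − 1 = −1. -/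
open MvPolynomial

/-! ## The functionals `Λ` -/

/-- The functional sending the monomial `X^e` to `∏ (e_j)_{ν_j} p_j^{e_j}`. -/
noncomputable def Lam (ν : Fin 4 → ℕ) (p : Fin 4 → ℚ) : MvPolynomial (Fin 4) ℚ →ₗ[ℚ] ℚ :=
  (basisMonomials (Fin 4) ℚ).constr ℚ fun e =>
    ∏ j, (((e j).descFactorial (ν j) : ℕ) : ℚ) * p j ^ e j

theorem Lam_monomial (ν : Fin 4 → ℕ) (p : Fin 4 → ℚ) (e : Fin 4 →₀ ℕ) :
    Lam ν p (monomial e 1) = ∏ j, (((e j).descFactorial (ν j) : ℕ) : ℚ) * p j ^ e j := by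
  have := (basisMonomials (Fin 4) ℚ).constr_basis ℚ (fun e : Fin 4 →₀ ℕ =>
    ∏ j, (((e j).descFactorial (ν j) : ℕ) : ℚ) * p j ^ e j) e
  simpa [Lam] using this

theorem pderiv_pow_monomial (i : Fin 4) (n : ℕ) (e : Fin 4 →₀ ℕ) (c : ℚ) :
    ((pderiv i).toLinearMap ^ n : Module.End ℚ (MvPolynomial (Fin 4) ℚ)) (monomial e c) =
      monomial (e - Finsupp.single i n) (c * ((e i).descFactorial n : ℕ)) := by
  induction n with
  | zero => simp
  | succ n ih =>
    rw [pow_succ', Module.End.mul_apply, ih]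
    simp only [Derivation.coeFn_coe, pderiv_monomial, Nat.descFactorial_succ]
    have he : e - Finsupp.single i n - Finsupp.single i 1 = e - Finsupp.single i (n + 1) := by
      ext j
      by_cases h : i = j
      · subst h; simp; omega
      · simp [h]
    rw [he]
    congr 1
    · simp only [Finsupp.coe_tsub, Pi.sub_apply, Finsupp.single_eq_same]
      push_cast
      ring

theorem diffOp_monomial (ν : Fin 4 → ℕ) (e : Fin 4 →₀ ℕ) :
    diffOp ν (monomial e 1) =
      monomial (e - Finsupp.equivFunOnFinite.symm ν)
        (∏ j, (((e j).descFactorial (ν j) : ℕ) : ℚ)) := by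
  simp only [diffOp, Module.End.mul_apply, pderiv_pow_monomial]
  have he : e - Finsupp.single 3 (ν 3) - Finsupp.single 2 (ν 2) - Finsupp.single 1 (ν 1) -
      Finsupp.single 0 (ν 0) = e - Finsupp.equivFunOnFinite.symm ν := by
    ext j
    fin_cases j <;> simp
  rw [he]
  congr 1
  · simp [Fin.prod_univ_four]
    ring

theorem Lam_eq (ν : Fin 4 → ℕ) (p : Fin 4 → ℚ) (f : MvPolynomial (Fin 4) ℚ) :
    Lam ν p f = (∏ j, p j ^ ν j) * aeval p (diffOp ν f) := by
  have : Lam ν p = (∏ j, p j ^ ν j) • ((aeval p).toLinearMap ∘ₗ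
      (diffOp ν : MvPolynomial (Fin 4) ℚ →ₗ[ℚ] MvPolynomial (Fin 4) ℚ)) := by
    apply (basisMonomials (Fin 4) ℚ).ext
    intro e
    simp only [coe_basisMonomials, LinearMap.smul_apply, LinearMap.comp_apply,
      AlgHom.toLinearMap_apply, smul_eq_mul]
    rw [Lam_monomial, diffOp_monomial, aeval_monomial, Finsupp.prod_fintype _ _ (by simp)]
    simp only [Algebra.algebraMap_self, RingHom.id_apply]
    rw [mul_left_comm, ← Finset.prod_mul_distrib, ← Finset.prod_mul_distrib]
    refine Finset.prod_congr rfl fun j _ => ?_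
    by_cases h : ν j ≤ e j
    · simp only [Finsupp.coe_tsub, Pi.sub_apply, Finsupp.equivFunOnFinite_symm_apply_apply]
      rw [← pow_add, Nat.add_sub_cancel' h]
    · rw [Nat.descFactorial_of_lt (by omega)]; simp
  rw [this]; simp

theorem mem_vanishing (m : ℕ) (p : Fin 4 → ℚ) (hp : ∀ i, p i ≠ 0)
    (f : MvPolynomial (Fin 4) ℚ) :
    f ∈ vanishingSpace m p ↔ ∀ ν : Fin 4 → ℕ, ∑ j, ν j < m → Lam ν p f = 0 := by
  have h0 : ∀ ν : Fin 4 → ℕ, (∏ j, p j ^ ν j) ≠ 0 := fun ν =>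
    Finset.prod_ne_zero_iff.2 fun j _ => pow_ne_zero _ (hp j)
  simp [vanishingSpace, Submodule.mem_iInf, Lam_eq, h0, LinearMap.mem_ker]

/-- The weight of an exponent. -/
def wgt (w : Fin 4 → ℕ) (e : Fin 4 →₀ ℕ) : ℕ := ∑ j, w j * e j

/-- The weighted scaling of the variables. -/
noncomputable def scale (w : Fin 4 → ℕ) (t : ℚ) :
    MvPolynomial (Fin 4) ℚ →ₗ[ℚ] MvPolynomial (Fin 4) ℚ :=
  (basisMonomials (Fin 4) ℚ).constr ℚ fun e => t ^ wgt w e • monomial e 1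

theorem scale_monomial (w : Fin 4 → ℕ) (t : ℚ) (e : Fin 4 →₀ ℕ) :
    scale w t (monomial e 1) = t ^ wgt w e • monomial e 1 := by
  have := (basisMonomials (Fin 4) ℚ).constr_basis ℚ (fun e : Fin 4 →₀ ℕ =>
    t ^ wgt w e • monomial e (1 : ℚ)) e
  simpa [scale] using this

/-- The scaled point. -/
def scalePt (w : Fin 4 → ℕ) (t : ℚ) (p : Fin 4 → ℚ) : Fin 4 → ℚ := fun i => t ^ w i * p i

theorem Lam_scale (ν w : Fin 4 → ℕ) (t : ℚ) (p : Fin 4 → ℚ) (f : MvPolynomial (Fin 4) ℚ) :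
    Lam ν p (scale w t f) = Lam ν (scalePt w t p) f := by
  have : Lam ν p ∘ₗ scale w t = Lam ν (scalePt w t p) := by
    apply (basisMonomials (Fin 4) ℚ).ext
    intro e
    simp only [coe_basisMonomials, LinearMap.comp_apply, scale_monomial, Lam_monomial, map_smul,
      smul_eq_mul, wgt, scalePt]
    rw [← Finset.prod_pow_eq_pow_sum, ← Finset.prod_mul_distrib]
    refine Finset.prod_congr rfl fun j _ => ?_
    rw [mul_pow, pow_mul]; ring
  rw [← this]; rfl

theorem scale_mem (w : Fin 4 → ℕ) (t : ℚ) (ht : t ≠ 0) (m : ℕ) (p : Fin 4 → ℚ)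
    (hp : ∀ i, p i ≠ 0) (f : MvPolynomial (Fin 4) ℚ)
    (hf : f ∈ vanishingSpace m (scalePt w t p)) : scale w t f ∈ vanishingSpace m p := by
  rw [mem_vanishing _ _ hp]
  rw [mem_vanishing m (scalePt w t p) (fun i => mul_ne_zero (pow_ne_zero _ ht) (hp i))] at hf
  intro ν hν
  rw [Lam_scale, hf ν hν]

/-! ## Perturbing an injective map -/

theorem eventually_injective {V W : Type*} [AddCommGroup V] [Module ℚ V] [FiniteDimensional ℚ V]
    [AddCommGroup W] [Module ℚ W] (n : ℕ) (N : ℕ → V →ₗ[ℚ] W)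
    (h0 : Function.Injective (N 0)) :
    ∀ᶠ t : ℚ in Filter.cofinite, ∀ v : V,
      ∑ k ∈ Finset.range (n + 1), t ^ k • N k v = 0 → v = 0 := by
  classical
  obtain ⟨G, hG⟩ := LinearMap.exists_leftInverse_of_injective (N 0) (LinearMap.ker_eq_bot.2 h0)
  let b := Module.finBasis ℚ V
  let A : Matrix _ _ (Polynomial ℚ) := ∑ k ∈ Finset.range (n + 1),
    (Polynomial.X ^ k : Polynomial ℚ) • (LinearMap.toMatrix b b (G ∘ₗ N k)).map Polynomial.C
  have key : ∀ t : ℚ, (A.det).eval t = LinearMap.det (G ∘ₗ ∑ k ∈ Finset.range (n + 1),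
      t ^ k • N k) := by
    intro t
    rw [← LinearMap.det_toMatrix b, ← Polynomial.coe_evalRingHom, RingHom.map_det]
    congr 1
    ext i j
    have hc : G ∘ₗ ∑ k ∈ Finset.range (n + 1), t ^ k • N k =
        ∑ k ∈ Finset.range (n + 1), t ^ k • (G ∘ₗ N k) := by
      ext v; simp
    rw [hc]
    simp only [A, Matrix.sum_apply, map_sum, map_smul, RingHom.mapMatrix_apply, Matrix.map_apply,
      Matrix.smul_apply, smul_eq_mul, Polynomial.coe_evalRingHom, Polynomial.eval_mul,
      Polynomial.eval_pow, Polynomial.eval_X, Polynomial.eval_C]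
  have hA : A.det ≠ 0 := by
    intro h
    have := key 0
    rw [h, Finset.sum_range_succ'] at this
    simp [hG] at this
  have hfin : {t : ℚ | (A.det).eval t = 0}.Finite := by
    have := A.det.roots.toFinset.finite_toSet
    refine this.subset fun t ht => ?_
    simpa [hA] using ht
  filter_upwards [hfin.compl_mem_cofinite] with t ht v hv
  have ht' : LinearMap.det (G ∘ₗ ∑ k ∈ Finset.range (n + 1), t ^ k • N k) ≠ 0 := by
    rw [← key]; exact ht
  have := (LinearMap.equivOfDetNeZero _ ht').injective
  apply this
  simp [hv]

/-! ## Non-special configurations supported on a set of exponents -/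

/-- Configurations of fat points with nonzero coordinates, pairwise non-proportional. -/
def Good (L : List (ℕ × (Fin 4 → ℚ))) : Prop :=
  (∀ x ∈ L, ∀ i, x.2 i ≠ 0) ∧ L.Pairwise fun x y => ∃ i j, x.2 i * y.2 j ≠ x.2 j * y.2 i

/-- There is no nonzero polynomial with exponents in `D` which vanishes on the fat points. -/
def NS (D : Set (Fin 4 →₀ ℕ)) (L : List (ℕ × (Fin 4 → ℚ))) : Prop :=
  Good L ∧ ∀ f : MvPolynomial (Fin 4) ℚ, (∀ e ∈ f.support, e ∈ D) →
    (∀ x ∈ L, f ∈ vanishingSpace x.1 x.2) → f = 0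

theorem eventually_indep (w : Fin 4 → ℕ) (hw : ∃ i j, w i < w j) (p q : Fin 4 → ℚ)
    (hp : ∀ i, p i ≠ 0) (hq : ∀ i, q i ≠ 0) :
    ∀ᶠ t : ℚ in Filter.cofinite,
      ∃ i j, scalePt w t p i * q j ≠ scalePt w t p j * q i := by
  obtain ⟨i, j, hij⟩ := hw
  let g : Polynomial ℚ := Polynomial.C (p i * q j) * Polynomial.X ^ w i -
    Polynomial.C (p j * q i) * Polynomial.X ^ w j
  have hg : g ≠ 0 := by
    intro h
    have := congrArg (fun r => Polynomial.coeff r (w i)) h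
    simp only [g, Polynomial.coeff_sub, Polynomial.coeff_C_mul, Polynomial.coeff_X_pow,
      if_pos, if_neg hij.ne, Polynomial.coeff_zero, mul_one, mul_zero, sub_zero] at this
    exact mul_ne_zero (hp i) (hq j) this
  have hfin : {t : ℚ | g.eval t = 0}.Finite := by
    have := g.roots.toFinset.finite_toSet
    refine this.subset fun t ht => ?_
    simpa [hg] using ht
  filter_upwards [hfin.compl_mem_cofinite] with t ht
  refine ⟨i, j, fun h => ht ?_⟩
  simp only [scalePt] at h
  simp [g]
  linear_combination h

set_option maxHeartbeats 1000000 in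
theorem degenerate (D1 D2 : Finset (Fin 4 →₀ ℕ)) (w : Fin 4 → ℕ) (hw : ∃ i j, w i < w j)
    (L1 L2 : List (ℕ × (Fin 4 → ℚ))) (hL1 : Good L1)
    (h1 : ∀ d ∈ D1, ∃ l : MvPolynomial (Fin 4) ℚ →ₗ[ℚ] ℚ,
      (∀ f, (∀ x ∈ L1, f ∈ vanishingSpace x.1 x.2) → l f = 0) ∧ l (monomial d 1) ≠ 0 ∧
      ∀ e ∈ D1 ∪ D2, e ≠ d → wgt w e ≤ wgt w d → l (monomial e 1) = 0)
    (h2 : NS ↑D2 L2) :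
    ∃ t : ℚ, NS ↑(D1 ∪ D2) (L1.map (fun x => (x.1, scalePt w t x.2)) ++ L2) := by
  classical
  choose! l hl1 hl2 hl3 using h1
  set D := D1 ∪ D2 with hD
  let T : (D → ℚ) →ₗ[ℚ] MvPolynomial (Fin 4) ℚ :=
    ∑ e : D, (LinearMap.proj e).smulRight (monomial e.1 1)
  have hT : ∀ c, T c = ∑ e : D, c e • monomial e.1 1 := by intro c; simp [T]
  let V : Submodule ℚ (D → ℚ) := (⨅ x ∈ L2, vanishingSpace x.1 x.2).comap T
  let N : ℕ → V →ₗ[ℚ] (D1 → ℚ) := fun k => (LinearMap.pi fun d : D1 =>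
    ∑ e : D, (if wgt w e.1 = wgt w d.1 + k then l d.1 (monomial e.1 1) else 0) •
      LinearMap.proj e) ∘ₗ V.subtype
  have hN : ∀ k c d, N k c d = ∑ e : D,
      (if wgt w e.1 = wgt w d.1 + k then l d.1 (monomial e.1 1) else 0) * c.1 e := by
    intro k c d
    simp only [N, LinearMap.comp_apply, LinearMap.pi_apply, LinearMap.sum_apply,
      LinearMap.smul_apply, LinearMap.proj_apply, smul_eq_mul, Submodule.subtype_apply]
  have hN0 : Function.Injective (N 0) := by
    rw [← LinearMap.ker_eq_bot, LinearMap.ker_eq_bot']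
    intro c hc
    have hz : ∀ e : D, e.1 ∈ D1 → c.1 e = 0 := by
      intro e he
      have := congrFun hc ⟨e.1, he⟩
      rw [hN, Finset.sum_eq_single e] at this
      · simpa [hl2 e.1 he] using this
      · intro e' _ hne
        by_cases h : wgt w e'.1 = wgt w e.1
        · rw [hl3 e.1 he e'.1 e'.2 (fun h => hne (Subtype.ext h)) h.le]; simp
        · simp [h]
      · simp
    have hTc : T c.1 = 0 := by
      apply h2.2
      · intro e he
        rw [mem_support_iff, hT, coeff_sum] at he
        by_contra hne
        apply he
        refine Finset.sum_eq_zero fun e' _ => ?_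
        by_cases h : e'.1 = e
        · have : e'.1 ∈ D1 := by
            have h'' : e'.1 ∈ D1 ∪ D2 := e'.2
            rcases Finset.mem_union.1 h'' with h' | h'
            · exact h'
            · exact absurd (h ▸ h') hne
          simp [hz e' this]
        · simp [coeff_monomial, h]
      · have := c.2
        simpa [V, Submodule.mem_iInf] using this
    ext e
    have := congrArg (coeff e.1) hTc
    rw [hT, coeff_sum, Finset.sum_eq_single e] at this
    · simpa using this
    · intro e' _ hne
      simp [coeff_monomial, Subtype.coe_injective.ne hne]
    · simp
  have ev1 := eventually_injective (∑ e ∈ D, wgt w e) N hN0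
  have ev2 : ∀ᶠ t : ℚ in Filter.cofinite, t ≠ 0 := by simp
  have ev3 : ∀ᶠ t : ℚ in Filter.cofinite, ∀ x ∈ L1, ∀ y ∈ L2,
      ∃ i j, scalePt w t x.2 i * y.2 j ≠ scalePt w t x.2 j * y.2 i := by
    have : ∀ x ∈ L1.toFinset, ∀ᶠ t : ℚ in Filter.cofinite, ∀ y ∈ L2.toFinset,
      ∃ i j, scalePt w t x.2 i * y.2 j ≠ scalePt w t x.2 j * y.2 i := by
      intro x hx
      refine (Filter.eventually_all_finset _).2 fun y hy => ?_
      exact eventually_indep w hw _ _ (hL1.1 x (by simpa using hx))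
        (h2.1.1 y (by simpa using hy))
    have := (Filter.eventually_all_finset _).2 this
    simpa using this
  obtain ⟨t, ⟨ht1, ht2⟩, ht3⟩ := ((ev1.and ev2).and ev3).exists
  refine ⟨t, ⟨?_, ?_⟩, ?_⟩
  · intro x hx i
    rcases List.mem_append.1 hx with hx | hx
    · obtain ⟨y, hy, rfl⟩ := List.mem_map.1 hx
      exact mul_ne_zero (pow_ne_zero _ ht2) (hL1.1 y hy i)
    · exact h2.1.1 x hx i
  · rw [List.pairwise_append]
    refine ⟨?_, h2.1.2, ?_⟩
    · rw [List.pairwise_map]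
      refine hL1.2.imp ?_
      rintro x y ⟨i, j, hij⟩
      refine ⟨i, j, fun h => hij ?_⟩
      simp only [scalePt] at h
      have h0 : t ^ w i * t ^ w j ≠ 0 := mul_ne_zero (pow_ne_zero _ ht2) (pow_ne_zero _ ht2)
      apply mul_left_cancel₀ h0
      linear_combination h
    · intro x hx y hy
      obtain ⟨z, hz, rfl⟩ := List.mem_map.1 hx
      exact ht3 z hz y hy
  · intro f hf hv
    have hTf : T (fun e => coeff e.1 f) = f := by
      ext e
      rw [hT, coeff_sum]
      by_cases he : e ∈ D
      · rw [Finset.sum_eq_single ⟨e, he⟩]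
        · simp
        · intro e' _ hne
          have : e'.1 ≠ e := fun h => hne (Subtype.ext h)
          simp [coeff_monomial, this]
        · simp
      · have : coeff e f = 0 := by
          by_contra h
          exact he (hf e (mem_support_iff.2 h))
        rw [this]
        refine Finset.sum_eq_zero fun e' _ => ?_
        have : e'.1 ≠ e := fun h => he (h ▸ e'.2)
        simp [coeff_monomial, this]
    have hmem : (fun e : D => coeff e.1 f) ∈ V := by
      simp only [V, Submodule.mem_comap, Submodule.mem_iInf, hTf]
      intro x hx
      exact hv x (List.mem_append_right _ hx)
    have hz := ht1 ⟨_, hmem⟩ ?_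
    · have := congrArg (fun c : V => T c.1) hz
      simpa [hTf] using this
    · ext d
      have hld : l d.1 (scale w t f) = 0 := by
        apply hl1 d.1 d.2
        intro x hx
        refine scale_mem w t ht2 x.1 x.2 (hL1.1 x hx) f ?_
        exact hv (x.1, scalePt w t x.2) (List.mem_append_left _ (List.mem_map.2 ⟨x, hx, rfl⟩))
      have hexp : l d.1 (scale w t f) = ∑ e : D, coeff e.1 f * (t ^ wgt w e.1 *
          l d.1 (monomial e.1 1)) := by
        conv_lhs => rw [← hTf, hT]
        simp [scale_monomial]
      rw [hexp] at hld
      have h0 : t ^ wgt w d.1 ≠ 0 := pow_ne_zero _ ht2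
      apply mul_left_cancel₀ h0
      simp only [Finset.sum_apply, Pi.smul_apply, hN, smul_eq_mul, Pi.zero_apply, mul_zero]
      refine Eq.trans ?_ hld
      simp only [Finset.mul_sum]
      rw [Finset.sum_comm]
      refine Finset.sum_congr rfl fun e _ => ?_
      by_cases hle : wgt w d.1 ≤ wgt w e.1
      · rw [Finset.sum_eq_single (wgt w e.1 - wgt w d.1)]
        · rw [if_pos (by omega)]
          have : t ^ wgt w e.1 = t ^ wgt w d.1 * t ^ (wgt w e.1 - wgt w d.1) := by
            rw [← pow_add]; congr 1; omega
          rw [this]; ring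
        · intro k _ hk
          rw [if_neg (by omega)]; ring
        · intro hk
          exfalso
          apply hk
          have : wgt w e.1 ≤ ∑ e ∈ D, wgt w e :=
            Finset.single_le_sum (f := fun e => wgt w e) (fun _ _ => Nat.zero_le _) e.2
          simp only [Finset.mem_range]; omega
      · have : l d.1 (monomial e.1 1) = 0 :=
          hl3 d.1 d.2 e.1 e.2 (fun h => hle (by rw [h])) (by omega)
        rw [this]
        simp

theorem NS_cut (A B : Finset (Fin 4 →₀ ℕ)) (w : Fin 4 → ℕ) (hw : ∃ i j, w i < w j)
    (hAB : ∀ a ∈ A, ∀ b ∈ B, wgt w a < wgt w b) (L1 L2 : List (ℕ × (Fin 4 → ℚ)))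
    (h1 : NS ↑A L1) (h2 : NS ↑B L2) :
    ∃ t : ℚ, NS ↑(A ∪ B) (L1.map (fun x => (x.1, scalePt w t x.2)) ++ L2) := by
  classical
  refine degenerate A B w hw L1 L2 h1.1 ?_ h2
  intro d hd
  let U : Submodule ℚ (MvPolynomial (Fin 4) ℚ) := ⨅ x ∈ L1, vanishingSpace x.1 x.2
  let Z : Submodule ℚ (MvPolynomial (Fin 4) ℚ) :=
    ⨅ e ∈ {e : Fin 4 →₀ ℕ | e ∉ A.erase d}, LinearMap.ker (lcoeff ℚ e)
  have hZ' : ∀ z, z ∈ Z ↔ ∀ e, e ∉ A.erase d → coeff e z = 0 := by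
    intro z
    simp only [Z, Submodule.mem_iInf, LinearMap.mem_ker, lcoeff_apply, Set.mem_ofPred_eq]
  have hZ : ∀ z ∈ Z, ∀ e, coeff e z ≠ 0 → e ∈ A.erase d := by
    intro z hz e he
    by_contra hne
    exact he ((hZ' z).1 hz e hne)
  have hnot : (monomial d 1 : MvPolynomial (Fin 4) ℚ) ∉ U ⊔ Z := by
    intro h
    obtain ⟨u, hu, z, hz, huz⟩ := Submodule.mem_sup.1 h
    have hzd : coeff d z = 0 := by
      by_contra hne
      simpa using hZ z hz d hne
    have hu0 : u = 0 := by
      apply h1.2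
      · intro e he
        rw [mem_support_iff] at he
        by_contra heA
        apply he
        have hze : coeff e z = 0 := by
          by_contra hne
          exact heA (Finset.mem_of_mem_erase (hZ z hz e hne))
        have := congrArg (coeff e) huz
        have hde : d ≠ e := fun h => heA (h ▸ hd)
        simpa [coeff_monomial, hze, hde] using this
      · simpa [U, Submodule.mem_iInf] using hu
    have := congrArg (coeff d) huz
    simp [hu0, hzd] at this
  obtain ⟨l, hl, hle⟩ := Submodule.exists_le_ker_of_notMem hnot
  refine ⟨l, ?_, hl, ?_⟩
  · intro f hf
    have : f ∈ U := by simpa [U, Submodule.mem_iInf] using hf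
    exact LinearMap.mem_ker.1 (hle (Submodule.mem_sup_left this))
  · intro e he hne hwe
    have heA : e ∈ A := by
      rcases Finset.mem_union.1 he with h | h
      · exact h
      · exact absurd (hAB d hd e h) (by omega)
    refine LinearMap.mem_ker.1 (hle (Submodule.mem_sup_right ?_))
    rw [hZ']
    intro e' he'
    rw [coeff_monomial, if_neg]
    rintro rfl
    exact he' (Finset.mem_erase.2 ⟨hne, heA⟩)
/-! ## The computable part

Everything is written with plain recursors, so that the kernel evaluates it quickly. -/

/-- Exponent (or weight) vectors in four variables, as computable data. -/
structure E4 where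
  x : ℕ
  y : ℕ
  z : ℕ
  u : ℕ

/-- An exponent with its vector of products of falling factorials. -/
structure PV where
  e : E4
  v : List ℤ

/-- Continuation-passing evaluation of a natural number (equal to `k n`). -/
noncomputable def forceN {α : Type} (n : ℕ) (k : ℕ → α) : α :=
  Nat.rec (motive := fun _ => α) (k 0) (fun m _ => k (Nat.succ m)) n

/-- Continuation-passing evaluation of an integer (equal to `k n`). -/
noncomputable def forceZ {α : Type} (n : ℤ) (k : ℤ → α) : α :=
  Int.rec (motive := fun _ => α) (fun m => forceN m fun m => k (Int.ofNat m))
    (fun m => forceN m fun m => k (Int.negSucc m)) n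

/-- Continuation-passing evaluation of an integer list. -/
noncomputable def forceP {α : Type} (l : List ℤ) : (List ℤ → α) → α :=
  List.rec (motive := fun _ => (List ℤ → α) → α) (fun k => k [])
    (fun a _ ih k => forceZ a fun a => ih fun l => k (a :: l)) l

/-- Continuation-passing evaluation of the spine of a list. -/
noncomputable def forceL {α β : Type} (l : List β) : (List β → α) → α :=
  List.rec (motive := fun _ => (List β → α) → α) (fun k => k [])
    (fun a _ ih k => ih fun l => k (a :: l)) l

/-- The weight of an exponent. -/
noncomputable def wt (w e : E4) : ℕ :=
  Nat.add (Nat.add (Nat.mul w.x e.x) (Nat.mul w.y e.y))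
    (Nat.add (Nat.mul w.z e.z) (Nat.mul w.u e.u))

/-- Dot product of integer lists. -/
noncomputable def dot (q : List ℤ) : List ℤ → ℤ :=
  List.rec (motive := fun _ => List ℤ → ℤ) (fun _ => Int.ofNat 0)
    (fun a _ ih v => List.rec (motive := fun _ => ℤ) (Int.ofNat 0)
      (fun b v _ => Int.add (Int.mul a b) (ih v)) v) q

/-- `c • q - d • p`. -/
noncomputable def comb (c d : ℤ) (q : List ℤ) : List ℤ → List ℤ :=
  List.rec (motive := fun _ => List ℤ → List ℤ) (fun _ => [])
    (fun a _ ih p => List.rec (motive := fun _ => List ℤ) []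
      (fun b p _ => Int.sub (Int.mul c a) (Int.mul d b) :: ih p) p) q

/-- The content of an integer list. -/
noncomputable def content (q : List ℤ) : ℕ :=
  List.rec (motive := fun _ => ℕ) 0 (fun a _ ih => Nat.gcd (Int.natAbs a) ih) q

/-- Divide an integer list by a number. -/
noncomputable def divBy (g : ℤ) (q : List ℤ) : List ℤ :=
  List.rec (motive := fun _ => List ℤ) [] (fun a _ ih => Int.tdiv a g :: ih) q

/-- Eliminate with a pivot form `p`, having value `c` at `v`. -/
noncomputable def redTail (v p : List ℤ) (c : ℤ) (qs : List (List ℤ)) : List (List ℤ) :=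
  List.rec (motive := fun _ => List (List ℤ)) []
    (fun q _ ih => forceZ (dot q v) fun d =>
      Nat.rec (motive := fun _ => List (List ℤ)) (q :: ih)
        (fun _ _ => forceP (comb c d q p) fun r => forceN (content r) fun g =>
          forceP (divBy (Int.ofNat g) r) fun r => r :: ih) (Int.natAbs d)) qs

/-- Search for a form which does not vanish at `v` and eliminate with it. -/
noncomputable def red (v : List ℤ) (qs : List (List ℤ)) : Option (List (List ℤ)) :=
  List.rec (motive := fun _ => Option (List (List ℤ))) none
    (fun q qs ih => forceZ (dot q v) fun c =>
      Nat.rec (motive := fun _ => Option (List (List ℤ)))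
        (Option.rec (motive := fun _ => Option (List (List ℤ))) none
          (fun l => some (q :: l)) ih)
        (fun _ _ => some (redTail v q c qs)) (Int.natAbs c)) qs

/-- Forget the keys. -/
noncomputable def unkey (S : List (ℕ × PV)) : List PV :=
  List.rec (motive := fun _ => List PV) [] (fun p _ ih => p.2 :: ih) S

/-- The greedy algorithm; returns the points which were not selected. -/
noncomputable def elim (S : List (ℕ × PV)) : List (List ℤ) → List PV :=
  List.rec (motive := fun _ => List (List ℤ) → List PV) (fun _ => [])
    (fun p S ih bs => List.rec (motive := fun _ => List PV) (p.2 :: unkey S)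
      (fun _ _ _ => Option.rec (motive := fun _ => List PV) (p.2 :: ih bs)
        (fun bs => forceL bs ih) (red p.2.v bs)) bs) S

/-- Insertion with respect to the first component. -/
noncomputable def ins (k : ℕ) (p : PV) (S : List (ℕ × PV)) : List (ℕ × PV) :=
  List.rec (motive := fun _ => List (ℕ × PV)) [(k, p)]
    (fun q l ih => Bool.rec (motive := fun _ => List (ℕ × PV)) (q :: ih) ((k, p) :: q :: l)
      (Nat.ble k q.1)) S

/-- Insertion sort by weight. -/
noncomputable def sortW (w : E4) (D : List PV) : List (ℕ × PV) :=
  List.rec (motive := fun _ => List (ℕ × PV)) []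
    (fun p _ ih => forceN (wt w p.e) fun k => ins k p ih) D

/-- Check that the first components increase strictly. -/
noncomputable def incr (S : List (ℕ × PV)) : Bool :=
  List.rec (motive := fun _ => Bool) true
    (fun p l ih => List.rec (motive := fun _ => Bool) true
      (fun q _ _ => Bool.rec (motive := fun _ => Bool) false ih
        (Nat.ble (Nat.succ p.1) q.1)) l) S

/-- The weight vector is not constant. -/
noncomputable def nonconst (w : E4) : Bool :=
  !(Nat.beq w.x w.y && Nat.beq w.x w.z && Nat.beq w.x w.u)

/-- One reduction. -/
noncomputable def step (us : List (List ℤ)) (w : E4) (D : List PV) : Option (List PV) :=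
  forceL (sortW w D) fun S =>
    Bool.rec (motive := fun _ => Option (List PV)) none (forceL (elim S us) some)
      (incr S && nonconst w)

/-- Indices of the derivatives of order less than four. -/
noncomputable def nus4 : List (ℕ × ℕ × ℕ) :=
  [(0, 0, 0), (1, 0, 0), (0, 1, 0), (0, 0, 1), (2, 0, 0), (1, 1, 0), (1, 0, 1), (0, 2, 0),
   (0, 1, 1), (0, 0, 2), (3, 0, 0), (2, 1, 0), (2, 0, 1), (1, 2, 0), (1, 1, 1), (1, 0, 2),
   (0, 3, 0), (0, 2, 1), (0, 1, 2), (0, 0, 3)]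

/-- The vector of products of falling factorials at an exponent. -/
noncomputable def evec (e : E4) : List ℤ :=
  nus4.map fun n => Int.ofNat
    (e.x.descFactorial n.1 * e.y.descFactorial n.2.1 * e.z.descFactorial n.2.2)

/-- Unit vectors. -/
noncomputable def units (n : ℕ) : List (List ℤ) :=
  (List.range n).map fun i => List.replicate i (Int.ofNat 0) ++ Int.ofNat 1 :: List.replicate (n - 1 - i) (Int.ofNat 0)

/-- A sequence of reductions with triple points ending in the empty set. -/
noncomputable def runT (us : List (List ℤ)) : List E4 → List PV → Bool
  | [], D => D.isEmpty
  | w :: ws, D => match step us w D with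
    | none => false
    | some D' => runT us ws D'

/-- Check of a piece. -/
noncomputable def runQ (us us' : List (List ℤ)) : List (E4 × List E4) → List PV → Bool
  | [], D => D.isEmpty
  | r :: rs, D => runT us r.2 D && Nat.beq r.2.length (2 * (rs.length + 1)) &&
    match step us' r.1 D with
    | none => false
    | some D' => runQ us us' rs D'

/-- Certificates. -/
inductive Cert where
  | cut (w : E4) (θ : ℕ) (l r : Cert)
  | piece (rows : List (E4 × List E4))

/-- Number of quadruple points of a certificate. -/
noncomputable def Cert.size : Cert → ℕ
  | .cut _ _ l r => l.size + r.size
  | .piece rows => rows.length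

/-- Check of a certificate. -/
noncomputable def Cert.check (us us' : List (List ℤ)) : Cert → List PV → Bool
  | .cut w θ l r, D =>
    nonconst w &&
    (forceL (D.filter fun p => Nat.blt (wt w p.e) θ) (l.check us us')) &&
    (forceL (D.filter fun p => !Nat.blt (wt w p.e) θ) (r.check us us'))
  | .piece rows, D => runQ us us' rows D

/-- Continuation-passing evaluation of a list of exponents, adding the vectors `evec`. -/
noncomputable def forceE {α : Type} : List E4 → (List PV → α) → α
  | [], k => k []
  | e :: l, k => forceN e.x fun x => forceN e.y fun y => forceN e.z fun z => forceN e.u fun u =>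
    forceP (evec ⟨x, y, z, u⟩) fun v => forceE l fun l => k (⟨⟨x, y, z, u⟩, v⟩ :: l)

/-- Continuation-passing evaluation of a list of integer lists. -/
noncomputable def forceU {α : Type} : List (List ℤ) → (List (List ℤ) → α) → α
  | [], k => k []
  | q :: l, k => forceP q fun q => forceU l fun l => k (q :: l)

/-- All exponents of degree 13. -/
noncomputable def D13 : List E4 :=
  (List.range 14).flatMap fun x => (List.range (14 - x)).flatMap fun y =>
    (List.range (14 - x - y)).map fun z => ⟨x, y, z, 13 - x - y - z⟩

/-- The complete check. -/
noncomputable def fullCheck (c : Cert) : Bool :=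
  forceU (units 10) fun us => forceU (units 20) fun us' => forceE D13 (c.check us us')

/-- The certificate: separating cuts and, for each piece, the weights of the reductions. -/
def theCert : Cert :=
  (.cut ⟨282, 216, 684, 0⟩ 3660
    (.cut ⟨875, 306, 662, 0⟩ 4554
      (.cut ⟨0, 77, 223, 476⟩ 3640
        (.piece [
          (⟨512, 0, 285, 261⟩,
            [⟨121, 562, 615, 0⟩, ⟨184, 757, 0, 507⟩, ⟨393, 74, 639, 0⟩, ⟨862, 0, 74, 629⟩,
             ⟨543, 0, 75, 293⟩, ⟨85, 401, 18, 0⟩]),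
          (⟨0, 21, 178, 228⟩,
            [⟨0, 303, 879, 893⟩, ⟨387, 0, 983, 645⟩, ⟨736, 0, 523, 233⟩, ⟨146, 749, 0, 523⟩]),
          (⟨231, 0, 585, 907⟩,
            [⟨140, 117, 144, 0⟩, ⟨359, 213, 756, 0⟩])])
        (.piece [
          (⟨385, 0, 606, 85⟩,
            [⟨0, 221, 194, 183⟩, ⟨421, 0, 595, 719⟩, ⟨353, 316, 0, 110⟩, ⟨283, 355, 259, 0⟩,
             ⟨10, 0, 46, 523⟩, ⟨0, 474, 574, 266⟩, ⟨65, 0, 87, 557⟩, ⟨0, 252, 291, 159⟩]),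
          (⟨47, 212, 0, 139⟩,
            [⟨56, 0, 33, 59⟩, ⟨0, 737, 783, 602⟩, ⟨0, 123, 834, 697⟩, ⟨266, 936, 406, 0⟩,
             ⟨264, 474, 7, 0⟩, ⟨0, 510, 530, 190⟩]),
          (⟨96, 436, 5, 0⟩,
            [⟨423, 161, 678, 0⟩, ⟨912, 0, 295, 410⟩, ⟨210, 0, 582, 629⟩, ⟨683, 734, 772, 0⟩]),
          (⟨334, 907, 674, 0⟩,
            [⟨0, 311, 551, 299⟩, ⟨200, 922, 0, 690⟩])]))
      (.cut ⟨673, 0, 516, 507⟩ 5586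
        (.piece [
          (⟨425, 174, 720, 0⟩,
            [⟨392, 387, 0, 461⟩, ⟨345, 255, 0, 526⟩, ⟨0, 121, 580, 362⟩, ⟨731, 0, 540, 718⟩,
             ⟨0, 269, 498, 697⟩, ⟨675, 671, 419, 0⟩]),
          (⟨0, 398, 493, 679⟩,
            [⟨193, 481, 318, 0⟩, ⟨0, 517, 23, 485⟩, ⟨221, 0, 879, 817⟩, ⟨0, 289, 184, 357⟩]),
          (⟨869, 438, 0, 631⟩,
            [⟨0, 421, 488, 407⟩, ⟨922, 296, 384, 0⟩])])
        (.piece [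
          (⟨0, 583, 598, 14⟩,
            [⟨430, 139, 0, 746⟩, ⟨334, 384, 0, 660⟩, ⟨126, 0, 54, 272⟩, ⟨85, 567, 145, 0⟩,
             ⟨143, 814, 217, 0⟩, ⟨0, 806, 782, 596⟩, ⟨614, 0, 128, 699⟩, ⟨0, 130, 447, 534⟩]),
          (⟨518, 731, 830, 0⟩,
            [⟨255, 665, 184, 0⟩, ⟨534, 0, 57, 790⟩, ⟨141, 272, 201, 0⟩, ⟨498, 0, 59, 34⟩,
             ⟨16, 29, 679, 0⟩, ⟨618, 427, 397, 0⟩]),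
          (⟨857, 0, 231, 812⟩,
            [⟨0, 4, 320, 179⟩, ⟨288, 534, 513, 0⟩, ⟨214, 0, 207, 61⟩, ⟨96, 0, 91, 282⟩]),
          (⟨10, 0, 101, 135⟩,
            [⟨625, 378, 490, 0⟩, ⟨0, 19, 367, 391⟩])])))
    (.cut ⟨307, 876, 814, 0⟩ 7726
      (.cut ⟨361, 17, 192, 0⟩ 2274
        (.piece [
          (⟨0, 713, 283, 257⟩,
            [⟨146, 343, 141, 0⟩, ⟨315, 45, 556, 0⟩, ⟨0, 508, 459, 214⟩, ⟨385, 604, 568, 0⟩,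
             ⟨422, 74, 322, 0⟩, ⟨0, 3, 188, 110⟩]),
          (⟨367, 0, 139, 359⟩,
            [⟨0, 534, 160, 172⟩, ⟨224, 274, 5, 0⟩, ⟨0, 356, 840, 525⟩, ⟨81, 472, 0, 720⟩]),
          (⟨154, 0, 413, 330⟩,
            [⟨674, 0, 712, 51⟩, ⟨79, 0, 873, 411⟩])])
        (.piece [
          (⟨0, 868, 781, 877⟩,
            [⟨235, 446, 0, 244⟩, ⟨0, 783, 361, 910⟩, ⟨0, 695, 496, 170⟩, ⟨706, 331, 433, 0⟩,
             ⟨593, 185, 0, 527⟩, ⟨277, 856, 0, 644⟩, ⟨0, 722, 850, 849⟩, ⟨0, 149, 152, 55⟩]),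
          (⟨461, 160, 0, 657⟩,
            [⟨543, 354, 3, 0⟩, ⟨0, 529, 802, 833⟩, ⟨432, 820, 134, 0⟩, ⟨505, 57, 0, 93⟩,
             ⟨353, 0, 625, 93⟩, ⟨444, 391, 69, 0⟩]),
          (⟨422, 858, 0, 435⟩,
            [⟨810, 541, 303, 0⟩, ⟨169, 8, 226, 0⟩, ⟨50, 0, 693, 852⟩, ⟨0, 238, 305, 738⟩]),
          (⟨410, 0, 150, 314⟩,
            [⟨434, 0, 42, 37⟩, ⟨0, 387, 115, 224⟩])]))
      (.cut ⟨0, 609, 191, 32⟩ 3355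
        (.piece [
          (⟨347, 0, 254, 614⟩,
            [⟨180, 245, 547, 0⟩, ⟨0, 691, 329, 799⟩, ⟨425, 905, 0, 940⟩, ⟨114, 0, 157, 132⟩,
             ⟨78, 339, 95, 0⟩, ⟨359, 225, 371, 0⟩]),
          (⟨0, 201, 180, 328⟩,
            [⟨762, 939, 92, 0⟩, ⟨443, 564, 0, 411⟩, ⟨906, 821, 0, 664⟩, ⟨609, 0, 472, 132⟩]),
          (⟨89, 0, 188, 422⟩,
            [⟨402, 0, 44, 955⟩, ⟨156, 0, 558, 192⟩])])
        (.piece [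
          (⟨527, 0, 725, 409⟩,
            [⟨925, 402, 0, 133⟩, ⟨479, 0, 474, 657⟩, ⟨291, 224, 0, 909⟩, ⟨0, 915, 597, 563⟩,
             ⟨59, 102, 0, 579⟩, ⟨117, 0, 10, 366⟩, ⟨0, 62, 683, 700⟩, ⟨729, 258, 365, 0⟩]),
          (⟨723, 787, 0, 903⟩,
            [⟨9, 536, 22, 0⟩, ⟨764, 693, 0, 130⟩, ⟨839, 471, 0, 339⟩, ⟨395, 0, 631, 598⟩,
             ⟨0, 202, 80, 170⟩, ⟨316, 0, 704, 435⟩]),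
          (⟨286, 15, 0, 97⟩,
            [⟨551, 328, 0, 264⟩, ⟨0, 105, 32, 352⟩, ⟨678, 0, 687, 535⟩, ⟨929, 0, 34, 642⟩]),
          (⟨12, 54, 0, 378⟩,
            [⟨386, 195, 660, 0⟩, ⟨618, 753, 0, 222⟩])]))))
/-! ## Correctness of the greedy algorithm -/

theorem forceN_eq {α : Type} (n : ℕ) (k : ℕ → α) : forceN n k = k n := by cases n <;> rfl

theorem forceZ_eq {α : Type} (n : ℤ) (k : ℤ → α) : forceZ n k = k n := by
  cases n with
  | ofNat m => exact forceN_eq m fun m => k (Int.ofNat m)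
  | negSucc m => exact forceN_eq m fun m => k (Int.negSucc m)

theorem forceP_eq {α : Type} (l : List ℤ) : ∀ k : List ℤ → α, forceP l k = k l := by
  induction l with
  | nil => intro k; rfl
  | cons a l ih =>
    intro k
    have : forceP (a :: l) k = forceZ a fun a => forceP l fun l => k (a :: l) := rfl
    rw [this, forceZ_eq, ih]

theorem forceL_eq {α β : Type} (l : List β) : ∀ k : List β → α, forceL l k = k l := by
  induction l with
  | nil => intro k; rfl
  | cons a l ih =>
    intro k
    have : forceL (a :: l) k = forceL l fun l => k (a :: l) := rfl
    rw [this, ih]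

theorem forceU_eq {α : Type} (l : List (List ℤ)) :
    ∀ k : List (List ℤ) → α, forceU l k = k l := by
  induction l with
  | nil => intro k; rfl
  | cons a l ih =>
    intro k
    rw [forceU, forceP_eq, ih]

theorem forceE_eq {α : Type} (l : List E4) :
    ∀ k : List PV → α, forceE l k = k (l.map fun e => ⟨e, evec e⟩) := by
  induction l with
  | nil => intro k; rfl
  | cons a l ih =>
    intro k
    rw [forceE, forceN_eq, forceN_eq, forceN_eq, forceN_eq, forceP_eq, ih]
    rfl

/-- The value of an integral form at a rational vector. -/
def qdot : List ℤ → List ℚ → ℚ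
  | [], _ => 0
  | _ :: _, [] => 0
  | a :: q, b :: v => a * b + qdot q v

theorem dot_cast (q : List ℤ) : ∀ v : List ℤ, ((dot q v : ℤ) : ℚ) = qdot q (v.map (fun x : ℤ => (x : ℚ))) := by
  induction q with
  | nil => intro v; rfl
  | cons a q ih =>
    intro v
    cases v with
    | nil => rfl
    | cons b v =>
      have : dot (a :: q) (b :: v) = a * b + dot q v := rfl
      rw [this]
      simp [qdot, ih]

theorem comb_length (c d : ℤ) (q : List ℤ) : ∀ p : List ℤ, q.length = p.length →
    (comb c d q p).length = q.length := by
  induction q with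
  | nil => intro p _; rfl
  | cons a q ih =>
    intro p h
    cases p with
    | nil => simp at h
    | cons b p =>
      have : comb c d (a :: q) (b :: p) = (c * a - d * b) :: comb c d q p := rfl
      rw [this]
      simp [ih p (by simpa using h)]

theorem qdot_comb (c d : ℤ) (q : List ℤ) : ∀ (p : List ℤ) (u : List ℚ), q.length = p.length →
    qdot (comb c d q p) u = c * qdot q u - d * qdot p u := by
  induction q with
  | nil =>
    intro p u h
    have : p = [] := by simpa using h.symm
    subst this
    have : comb c d [] [] = [] := rfl
    rw [this]
    simp [qdot]
  | cons a q ih =>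
    intro p u h
    cases p with
    | nil => simp at h
    | cons b p =>
      have : comb c d (a :: q) (b :: p) = (c * a - d * b) :: comb c d q p := rfl
      rw [this]
      cases u with
      | nil => simp [qdot]
      | cons y u =>
        simp only [qdot, ih p u (by simpa using h)]
        push_cast
        ring

theorem content_dvd (q : List ℤ) : ∀ a ∈ q, (Int.ofNat (content q)) ∣ a := by
  induction q with
  | nil => simp
  | cons b q ih =>
    have : content (b :: q) = Nat.gcd (Int.natAbs b) (content q) := rfl
    rw [this]
    intro a ha
    rcases List.mem_cons.1 ha with rfl | ha
    · exact Int.natCast_dvd.2 (Nat.gcd_dvd_left _ _)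
    · refine dvd_trans ?_ (ih a ha)
      exact Int.natCast_dvd_natCast.2 (Nat.gcd_dvd_right _ _)

theorem divBy_length (g : ℤ) (q : List ℤ) : (divBy g q).length = q.length := by
  induction q with
  | nil => rfl
  | cons a q ih =>
    have : divBy g (a :: q) = Int.tdiv a g :: divBy g q := rfl
    rw [this]
    simp [ih]

theorem qdot_divBy_zero (q : List ℤ) : ∀ u, qdot (divBy 0 q) u = 0 := by
  induction q with
  | nil => intro u; rfl
  | cons a q ih =>
    intro u
    have : divBy 0 (a :: q) = Int.tdiv a 0 :: divBy 0 q := rfl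
    rw [this]
    cases u with
    | nil => rfl
    | cons b u => simp [qdot, ih]

theorem qdot_divBy (g : ℤ) (q : List ℤ) : (∀ a ∈ q, g ∣ a) → ∀ u,
    g * qdot (divBy g q) u = qdot q u := by
  induction q with
  | nil => intro _ u; simp [divBy, qdot]
  | cons a q ih =>
    intro h u
    have : divBy g (a :: q) = Int.tdiv a g :: divBy g q := rfl
    rw [this]
    cases u with
    | nil => simp [qdot]
    | cons b u =>
      have ha : (g : ℚ) * (Int.tdiv a g : ℤ) = a := by
        have := Int.mul_tdiv_cancel' (h a (by simp))
        exact_mod_cast this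
      simp only [qdot]
      rw [mul_add, ih (fun a ha => h a (by simp [ha])) u, ← mul_assoc, ha]

theorem qdot_divBy_eq_zero (g : ℤ) (q : List ℤ) (h : ∀ a ∈ q, g ∣ a) (u : List ℚ)
    (hu : qdot q u = 0) : qdot (divBy g q) u = 0 := by
  by_cases hg : g = 0
  · subst hg; exact qdot_divBy_zero q u
  · have := qdot_divBy g q h u
    rw [hu] at this
    rcases mul_eq_zero.1 this with h | h
    · exact absurd (by exact_mod_cast h) hg
    · exact h

theorem redTail_cons (v p : List ℤ) (c : ℤ) (q : List ℤ) (qs : List (List ℤ)) :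
    redTail v p c (q :: qs) = if dot q v = 0 then q :: redTail v p c qs else
      divBy (Int.ofNat (content (comb c (dot q v) q p))) (comb c (dot q v) q p) ::
        redTail v p c qs := by
  have : redTail v p c (q :: qs) = forceZ (dot q v) fun d =>
      Nat.rec (motive := fun _ => List (List ℤ)) (q :: redTail v p c qs)
        (fun _ _ => forceP (comb c d q p) fun r => forceN (content r) fun g =>
          forceP (divBy (Int.ofNat g) r) fun r => r :: redTail v p c qs) (Int.natAbs d) := rfl
  rw [this, forceZ_eq]
  simp only [forceP_eq, forceN_eq]
  split_ifs with h
  · rw [h]; rfl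
  · obtain ⟨k, hk⟩ := Nat.exists_eq_succ_of_ne_zero (Int.natAbs_ne_zero.2 h)
    rw [hk]

/-- Casting a vector of integers. -/
def qv (v : List ℤ) : List ℚ := v.map (fun x : ℤ => (x : ℚ))

theorem redTail_spec (v p : List ℤ) (c : ℤ) (hc : dot p v = c) (n : ℕ) (hp : p.length = n)
    (qs : List (List ℤ)) (hqs : ∀ q ∈ qs, q.length = n) :
    ∀ r ∈ redTail v p c qs, r.length = n ∧ qdot r (qv v) = 0 ∧
      ∀ u, qdot p u = 0 → (∀ q ∈ qs, qdot q u = 0) → qdot r u = 0 := by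
  induction qs with
  | nil => intro r hr; simp [redTail] at hr
  | cons q qs ih =>
    have ih' := ih fun q hq => hqs q (by simp [hq])
    have hq : q.length = n := hqs q (by simp)
    intro r hr
    rw [redTail_cons] at hr
    split_ifs at hr with h
    · rcases List.mem_cons.1 hr with rfl | hr
      · refine ⟨hq, ?_, fun u _ hu => hu r (by simp)⟩
        rw [qv, ← dot_cast, h]; simp
      · obtain ⟨h1, h2, h3⟩ := ih' r hr
        exact ⟨h1, h2, fun u hp hu => h3 u hp fun q hq => hu q (by simp [hq])⟩
    · rcases List.mem_cons.1 hr with rfl | hr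
      · have hl : q.length = p.length := by rw [hq, hp]
        refine ⟨by rw [divBy_length, comb_length _ _ _ _ hl, hq], ?_, fun u hp hu => ?_⟩
        · apply qdot_divBy_eq_zero _ _ (content_dvd _)
          rw [qdot_comb _ _ _ _ _ hl, qv, ← dot_cast, ← dot_cast, hc]
          ring
        · apply qdot_divBy_eq_zero _ _ (content_dvd _)
          rw [qdot_comb _ _ _ _ _ hl, hp, hu q (by simp)]
          ring
      · obtain ⟨h1, h2, h3⟩ := ih' r hr
        exact ⟨h1, h2, fun u hp hu => h3 u hp fun q hq => hu q (by simp [hq])⟩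

theorem red_cons (v q : List ℤ) (qs : List (List ℤ)) :
    red v (q :: qs) = if dot q v = 0 then (red v qs).map (fun l => q :: l) else
      some (redTail v q (dot q v) qs) := by
  have : red v (q :: qs) = forceZ (dot q v) fun c =>
      Nat.rec (motive := fun _ => Option (List (List ℤ)))
        (Option.rec (motive := fun _ => Option (List (List ℤ))) none
          (fun l => some (q :: l)) (red v qs))
        (fun _ _ => some (redTail v q c qs)) (Int.natAbs c) := rfl
  rw [this, forceZ_eq]
  split_ifs with h
  · rw [h]
    cases red v qs <;> rfl
  · obtain ⟨k, hk⟩ := Nat.exists_eq_succ_of_ne_zero (Int.natAbs_ne_zero.2 h)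
    rw [hk]

theorem red_none (v : List ℤ) (qs : List (List ℤ)) (h : red v qs = none) :
    ∀ q ∈ qs, qdot q (qv v) = 0 := by
  induction qs with
  | nil => simp
  | cons q qs ih =>
    rw [red_cons] at h
    split_ifs at h with h0
    have h1 := ih (by simpa using h)
    intro r hr
    rcases List.mem_cons.1 hr with rfl | hr
    · rw [qv, ← dot_cast, h0]; simp
    · exact h1 r hr

theorem red_some (v : List ℤ) (n : ℕ) (qs : List (List ℤ)) (hqs : ∀ q ∈ qs, q.length = n) :
    ∀ bs, red v qs = some bs → (∃ p ∈ qs, qdot p (qv v) ≠ 0) ∧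
      ∀ r ∈ bs, r.length = n ∧ qdot r (qv v) = 0 ∧
        ∀ u, (∀ q ∈ qs, qdot q u = 0) → qdot r u = 0 := by
  induction qs with
  | nil => intro bs h; simp [red] at h
  | cons q qs ih =>
    have ih' := ih fun q hq => hqs q (by simp [hq])
    have hq : q.length = n := hqs q (by simp)
    intro bs h
    rw [red_cons] at h
    split_ifs at h with h0
    · obtain ⟨bs', h1, rfl⟩ := Option.map_eq_some_iff.1 h
      obtain ⟨⟨p, hp, hp'⟩, h2⟩ := ih' bs' h1
      refine ⟨⟨p, by simp [hp], hp'⟩, ?_⟩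
      intro r hr
      rcases List.mem_cons.1 hr with rfl | hr
      · refine ⟨hq, ?_, fun u hu => hu r (by simp)⟩
        rw [qv, ← dot_cast, h0]; simp
      · obtain ⟨h3, h4, h5⟩ := h2 r hr
        exact ⟨h3, h4, fun u hu => h5 u fun q hq => hu q (by simp [hq])⟩
    · obtain rfl := Option.some.inj h
      refine ⟨⟨q, by simp, ?_⟩, ?_⟩
      · rw [qv, ← dot_cast]; exact_mod_cast h0
      · intro r hr
        obtain ⟨h3, h4, h5⟩ := redTail_spec v q _ rfl n hq qs
          (fun q hq => hqs q (by simp [hq])) r hr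
        exact ⟨h3, h4, fun u hu => h5 u (hu q (by simp)) fun q hq => hu q (by simp [hq])⟩

theorem unkey_eq (S : List (ℕ × PV)) : unkey S = S.map Prod.snd := by
  induction S with
  | nil => rfl
  | cons p S ih =>
    have : unkey (p :: S) = p.2 :: unkey S := rfl
    rw [this, ih]; rfl

theorem elim_nil (S : List (ℕ × PV)) : elim S [] = S.map Prod.snd := by
  cases S with
  | nil => rfl
  | cons p S =>
    have : elim (p :: S) [] = p.2 :: unkey S := rfl
    rw [this, unkey_eq]; rfl

theorem elim_cons (p : ℕ × PV) (S : List (ℕ × PV)) (b : List ℤ) (bs : List (List ℤ)) :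
    elim (p :: S) (b :: bs) = match red p.2.v (b :: bs) with
      | none => p.2 :: elim S (b :: bs)
      | some bs' => elim S bs' := by
  have : elim (p :: S) (b :: bs) = Option.rec (motive := fun _ => List PV)
      (p.2 :: elim S (b :: bs)) (fun bs => forceL bs (elim S)) (red p.2.v (b :: bs)) := rfl
  rw [this]
  cases red p.2.v (b :: bs) with
  | none => rfl
  | some bs' => exact forceL_eq _ _

theorem elim_spec (n : ℕ) (S : List (ℕ × PV)) (hS : S.Pairwise fun p q => p.1 < q.1) :
    ∀ bs : List (List ℤ), (∀ q ∈ bs, q.length = n) →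
      (∀ x ∈ elim S bs, x ∈ S.map Prod.snd) ∧
      ∀ p ∈ S, p.2 ∈ elim S bs ∨ ∃ ψ : List ℤ, qdot ψ (qv p.2.v) ≠ 0 ∧
        (∀ q ∈ S, q.1 ≤ p.1 → q ≠ p → qdot ψ (qv q.2.v) = 0) ∧
        ∀ u, (∀ χ ∈ bs, qdot χ u = 0) → qdot ψ u = 0 := by
  induction S with
  | nil => intro bs _; simp [elim]
  | cons p S ih =>
    obtain ⟨hp, hS'⟩ := List.pairwise_cons.1 hS
    intro bs hbs
    cases bs with
    | nil =>
      rw [elim_nil]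
      exact ⟨fun x hx => hx, fun q hq => Or.inl (List.mem_map.2 ⟨q, hq, rfl⟩)⟩
    | cons b bs =>
      rw [elim_cons]
      cases hr : red p.2.v (b :: bs) with
      | none =>
        obtain ⟨h1, h2⟩ := ih hS' (b :: bs) hbs
        have h0 := red_none _ _ hr
        simp only
        refine ⟨?_, ?_⟩
        · intro x hx
          rcases List.mem_cons.1 hx with rfl | hx
          · simp
          · exact List.mem_cons_of_mem _ (h1 x hx)
        · intro q hq
          rcases List.mem_cons.1 hq with rfl | hq
          · left; simp
          · rcases h2 q hq with h | ⟨ψ, h3, h4, h5⟩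
            · left; exact List.mem_cons_of_mem _ h
            · right
              refine ⟨ψ, h3, ?_, h5⟩
              intro r hr hle hne
              rcases List.mem_cons.1 hr with rfl | hr
              · exact h5 _ h0
              · exact h4 r hr hle hne
      | some bs' =>
        obtain ⟨⟨χ, hχ, hχ'⟩, h0⟩ := red_some _ n _ hbs _ hr
        obtain ⟨h1, h2⟩ := ih hS' bs' fun q hq => (h0 q hq).1
        simp only
        refine ⟨fun x hx => List.mem_cons_of_mem _ (h1 x hx), ?_⟩
        intro q hq
        rcases List.mem_cons.1 hq with rfl | hq
        · right
          refine ⟨χ, hχ', ?_, fun u hu => hu χ hχ⟩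
          intro r hr hle hne
          rcases List.mem_cons.1 hr with rfl | hr
          · exact absurd rfl hne
          · exact absurd (hp r hr) (by omega)
        · rcases h2 q hq with h | ⟨ψ, h3, h4, h5⟩
          · left; exact h
          · right
            refine ⟨ψ, h3, ?_, fun u hu => h5 u fun χ hχ => (h0 χ hχ).2.2 u hu⟩
            intro r hr hle hne
            rcases List.mem_cons.1 hr with rfl | hr
            · exact h5 _ fun χ hχ => (h0 χ hχ).2.1
            · exact h4 r hr hle hne

theorem ins_perm (k : ℕ) (p : PV) (S : List (ℕ × PV)) : (ins k p S).Perm ((k, p) :: S) := by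
  induction S with
  | nil => exact List.Perm.refl _
  | cons q S ih =>
    have : ins k p (q :: S) = Bool.rec (motive := fun _ => List (ℕ × PV)) (q :: ins k p S)
      ((k, p) :: q :: S) (Nat.ble k q.1) := rfl
    rw [this]
    cases Nat.ble k q.1 with
    | false => exact (ih.cons q).trans (List.Perm.swap _ _ _)
    | true => exact List.Perm.refl _

theorem sortW_perm (w : E4) (D : List PV) :
    (sortW w D).Perm (D.map fun p => (wt w p.e, p)) := by
  induction D with
  | nil => exact List.Perm.refl _
  | cons p D ih =>
    have : sortW w (p :: D) = forceN (wt w p.e) fun k => ins k p (sortW w D) := rfl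
    rw [this, forceN_eq]
    exact (ins_perm _ _ _).trans (ih.cons _)

theorem incr_pairwise (S : List (ℕ × PV)) (h : incr S = true) :
    S.Pairwise fun p q => p.1 < q.1 := by
  have key : S.IsChain fun p q => p.1 < q.1 := by
    induction S with
    | nil => exact List.isChain_nil
    | cons p S ih =>
      cases S with
      | nil => exact List.isChain_singleton _
      | cons q S =>
        have h' : incr (p :: q :: S) = Bool.rec (motive := fun _ => Bool) false (incr (q :: S))
          (Nat.ble (Nat.succ p.1) q.1) := rfl
        rw [h'] at h
        cases hb : Nat.ble (Nat.succ p.1) q.1 with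
        | false => rw [hb] at h; cases h
        | true =>
          rw [hb] at h
          exact List.isChain_cons_cons.2 ⟨Nat.le_of_ble_eq_true hb, ih h⟩
  have : IsTrans (ℕ × PV) fun p q => p.1 < q.1 := ⟨fun _ _ _ h1 h2 => lt_trans h1 h2⟩
  exact key.pairwise

/-! ## From the computation to polynomials -/

/-- Exponents as finitely supported functions. -/
noncomputable def toFs (e : E4) : Fin 4 →₀ ℕ := Finsupp.equivFunOnFinite.symm ![e.x, e.y, e.z, e.u]

/-- Weights as functions. -/
def toW (w : E4) : Fin 4 → ℕ := ![w.x, w.y, w.z, w.u]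

theorem wgt_toFs (w e : E4) : wgt (toW w) (toFs e) = wt w e := by
  have : wt w e = (w.x * e.x + w.y * e.y) + (w.z * e.z + w.u * e.u) := rfl
  rw [this]
  simp [wgt, toW, toFs, Fin.sum_univ_four]
  ring

/-- The set of exponents of a list. -/
noncomputable def ES (D : List PV) : Finset (Fin 4 →₀ ℕ) :=
  open Classical in (D.map fun p => toFs p.e).toFinset

theorem mem_ES (D : List PV) (e : Fin 4 →₀ ℕ) : e ∈ ES D ↔ ∃ p ∈ D, toFs p.e = e := by
  simp [ES]

/-- The point `(1,1,1,1)`. -/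
def ones : Fin 4 → ℚ := fun _ => 1

/-- The functionals given by the list of derivatives. -/
noncomputable def funs : List (MvPolynomial (Fin 4) ℚ →ₗ[ℚ] ℚ) :=
  nus4.map fun n => Lam ![n.1, n.2.1, n.2.2, 0] ones

/-- A form as a functional. -/
noncomputable def qlin : List ℤ → List (MvPolynomial (Fin 4) ℚ →ₗ[ℚ] ℚ) →
    (MvPolynomial (Fin 4) ℚ →ₗ[ℚ] ℚ)
  | [], _ => 0
  | _ :: _, [] => 0
  | a :: q, l :: ls => (a : ℚ) • l + qlin q ls

theorem qlin_apply (q : List ℤ) : ∀ (ls : List (MvPolynomial (Fin 4) ℚ →ₗ[ℚ] ℚ))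
    (f : MvPolynomial (Fin 4) ℚ), qlin q ls f = qdot q (ls.map fun l => l f) := by
  induction q with
  | nil => intro ls f; rfl
  | cons a q ih =>
    intro ls f
    cases ls with
    | nil => rfl
    | cons l ls => simp [qlin, qdot, ih]

theorem funs_monomial (e : E4) :
    (funs.map fun l => l (monomial (toFs e) 1)) = qv (evec e) := by
  simp only [funs, qv, evec, List.map_map]
  refine List.map_congr_left fun n _ => ?_
  simp [Lam_monomial, Fin.prod_univ_four, ones, toFs]

theorem qdot_take (n : ℕ) : ∀ (χ : List ℤ) (u : List ℚ), χ.length = n →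
    (∀ x ∈ u.take n, x = 0) → qdot χ u = 0 := by
  induction n with
  | zero =>
    intro χ u h _
    have : χ = [] := by simpa using h
    subst this; rfl
  | succ n ih =>
    intro χ u h hu
    cases χ with
    | nil => rfl
    | cons a χ =>
      cases u with
      | nil => rfl
      | cons b u =>
        have hb : b = 0 := hu b (by simp)
        have := ih χ u (by simpa using h) fun x hx => hu x (by simp [hx])
        simp [qdot, hb, this]

/-- The first `n` functionals are controlled by vanishing to order `m`. -/
def Order (m n : ℕ) : Prop := ∀ f ∈ vanishingSpace m ones, ∀ x ∈ (funs.map fun l => l f).take n, x = 0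

theorem order_aux (m n : ℕ) (h : ∀ ν ∈ nus4.take n, ν.1 + ν.2.1 + ν.2.2 < m) : Order m n := by
  intro f hf x hx
  rw [mem_vanishing _ _ (by simp [ones])] at hf
  rw [funs, List.map_map, ← List.map_take] at hx
  obtain ⟨ν, hν, rfl⟩ := List.mem_map.1 hx
  apply hf
  simpa [Fin.sum_univ_four] using h ν hν

theorem order3 : Order 3 10 := order_aux 3 10 (by simp [nus4])

theorem order4 : Order 4 20 := order_aux 4 20 (by simp [nus4])

theorem nonconst_spec (w : E4) (h : nonconst w = true) : ∃ i j, toW w i < toW w j := by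
  by_contra! hc
  have h1 := le_antisymm (hc 0 1) (hc 1 0)
  have h2 := le_antisymm (hc 0 2) (hc 2 0)
  have h3 := le_antisymm (hc 0 3) (hc 3 0)
  simp [toW] at h1 h2 h3
  simp [nonconst, h1, h2, h3] at h

/-- All vectors in the list are correct. -/
def Valid (D : List PV) : Prop := ∀ p ∈ D, p.v = evec p.e

theorem step_spec (us : List (List ℤ)) (m n : ℕ) (hus : ∀ χ ∈ us, χ.length = n)
    (hm : Order m n) (w : E4) (D D' : List PV) (hD : Valid D) (h : step us w D = some D') :
    Valid D' ∧ ∀ L, NS ↑(ES D') L → ∃ p, NS ↑(ES D) ((m, p) :: L) := by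
  classical
  rw [step, forceL_eq, forceL_eq] at h
  cases hb : (incr (sortW w D) && nonconst w) with
  | false => rw [hb] at h; cases h
  | true =>
    rw [hb] at h
    have hD' : elim (sortW w D) us = D' := Option.some.inj h
    rw [Bool.and_eq_true] at hb
    obtain ⟨hi, hn⟩ := hb
    have hperm := sortW_perm w D
    have hmemS : ∀ p : ℕ × PV, p ∈ sortW w D ↔ p.2 ∈ D ∧ p.1 = wt w p.2.e := by
      intro p
      rw [hperm.mem_iff, List.mem_map]
      constructor
      · rintro ⟨q, hq, rfl⟩
        exact ⟨hq, rfl⟩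
      · rintro ⟨h1, h2⟩
        exact ⟨p.2, h1, by rw [← h2]⟩
    obtain ⟨e1, e2⟩ := elim_spec n (sortW w D) (incr_pairwise _ hi) us hus
    rw [hD'] at e1 e2
    have hsub : ∀ x ∈ D', x ∈ D := by
      intro x hx
      obtain ⟨q, hq, rfl⟩ := List.mem_map.1 (e1 x hx)
      exact ((hmemS q).1 hq).1
    refine ⟨fun p hp => hD p (hsub p hp), fun L hL => ?_⟩
    have hun : (ES D \ ES D') ∪ ES D' = ES D := by
      apply Finset.sdiff_union_of_subset
      intro e he
      obtain ⟨p, hp, rfl⟩ := (mem_ES _ _).1 he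
      exact (mem_ES _ _).2 ⟨p, hsub p hp, rfl⟩
    have hdeg := degenerate (ES D \ ES D') (ES D') (toW w) (nonconst_spec w hn)
      [(m, ones)] L ⟨by simp [ones], by simp⟩ ?_ hL
    · obtain ⟨t, ht⟩ := hdeg
      rw [hun] at ht
      exact ⟨_, ht⟩
    · intro d hd
      obtain ⟨hd1, hd2⟩ := Finset.mem_sdiff.1 hd
      obtain ⟨p, hp, rfl⟩ := (mem_ES _ _).1 hd1
      rcases e2 (wt w p.e, p) ((hmemS _).2 ⟨hp, rfl⟩) with h1 | ⟨ψ, h1, h2, h3⟩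
      · exact absurd ((mem_ES _ _).2 ⟨p, h1, rfl⟩) hd2
      · refine ⟨qlin ψ funs, ?_, ?_, ?_⟩
        · intro f hf
          have hf' := hf (m, ones) (by simp)
          rw [qlin_apply]
          apply h3
          intro χ hχ
          exact qdot_take n χ _ (hus χ hχ) (hm f hf')
        · rw [qlin_apply, funs_monomial, ← hD p hp]
          exact h1
        · intro e he hne hle
          rw [hun] at he
          obtain ⟨q, hq, rfl⟩ := (mem_ES _ _).1 he
          rw [wgt_toFs, wgt_toFs] at hle
          rw [qlin_apply, funs_monomial, ← hD q hq]
          refine h2 (wt w q.e, q) ((hmemS _).2 ⟨hq, rfl⟩) hle ?_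
          intro heq
          apply hne
          have hqp : q = p := (Prod.ext_iff.1 heq).2
          rw [hqp]

/-- Existence of a configuration with `a` quadruple and `b` triple points. -/
def Conf (D : Finset (Fin 4 →₀ ℕ)) (a b : ℕ) : Prop :=
  ∃ L, NS ↑D L ∧ (L.map Prod.fst).Perm (List.replicate a 4 ++ List.replicate b 3)

theorem Conf_empty : Conf (ES []) 0 0 := by
  refine ⟨[], ⟨⟨by simp, by simp⟩, ?_⟩, by simp⟩
  intro f hf _
  have : f.support = ∅ := by
    apply Finset.eq_empty_of_forall_notMem
    intro e he
    have := hf e he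
    simp [ES] at this
  exact MvPolynomial.support_eq_empty.1 this

theorem runT_spec (us : List (List ℤ)) (hus : ∀ χ ∈ us, χ.length = 10) (ws : List E4) :
    ∀ D, Valid D → runT us ws D = true → Conf (ES D) 0 ws.length := by
  induction ws with
  | nil =>
    intro D _ h
    have : D = [] := by simpa [runT] using h
    subst this
    exact Conf_empty
  | cons w ws ih =>
    intro D hD h
    rw [runT] at h
    cases hs : step us w D with
    | none => rw [hs] at h; simp at h
    | some D' =>
      rw [hs] at h
      obtain ⟨h1, h2⟩ := step_spec us 3 10 hus order3 w D D' hD hs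
      obtain ⟨L, hL, hp⟩ := ih D' h1 h
      obtain ⟨p, hp'⟩ := h2 L hL
      refine ⟨_, hp', ?_⟩
      simpa [List.replicate_succ] using hp

theorem runQ_spec (us us' : List (List ℤ)) (hus : ∀ χ ∈ us, χ.length = 10)
    (hus' : ∀ χ ∈ us', χ.length = 20) (rows : List (E4 × List E4)) :
    ∀ D, Valid D → runQ us us' rows D = true → ∀ a ≤ rows.length,
      Conf (ES D) a (2 * (rows.length - a)) := by
  induction rows with
  | nil =>
    intro D _ h a ha
    have : D = [] := by simpa [runQ] using h
    subst this
    have : a = 0 := by simpa using ha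
    subst this
    exact Conf_empty
  | cons r rows ih =>
    intro D hD h a ha
    rw [runQ, Bool.and_eq_true, Bool.and_eq_true] at h
    obtain ⟨⟨h1, h2⟩, h3⟩ := h
    cases a with
    | zero =>
      have := runT_spec us hus r.2 D hD h1
      rw [Nat.eq_of_beq_eq_true h2] at this
      simpa using this
    | succ a =>
      cases hs : step us' r.1 D with
      | none => rw [hs] at h3; simp at h3
      | some D' =>
        rw [hs] at h3
        obtain ⟨h4, h5⟩ := step_spec us' 4 20 hus' order4 r.1 D D' hD hs
        obtain ⟨L, hL, hp⟩ := ih D' h4 h3 a (by simpa using ha)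
        obtain ⟨p, hp'⟩ := h5 L hL
        refine ⟨_, hp', ?_⟩
        simpa [List.replicate_succ] using hp

theorem Conf_cut (w : E4) (θ : ℕ) (hn : nonconst w = true) (D : List PV) (a b a' b' : ℕ)
    (h1 : Conf (ES (D.filter fun p => Nat.blt (wt w p.e) θ)) a b)
    (h2 : Conf (ES (D.filter fun p => !Nat.blt (wt w p.e) θ)) a' b') :
    Conf (ES D) (a + a') (b + b') := by
  classical
  obtain ⟨L1, hL1, hp1⟩ := h1
  obtain ⟨L2, hL2, hp2⟩ := h2
  have hcut := NS_cut _ _ (toW w) (nonconst_spec w hn) ?_ L1 L2 hL1 hL2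
  · obtain ⟨t, ht⟩ := hcut
    have hun : ES (D.filter fun p => Nat.blt (wt w p.e) θ) ∪
        ES (D.filter fun p => !Nat.blt (wt w p.e) θ) = ES D := by
      ext e
      simp only [Finset.mem_union, mem_ES, List.mem_filter]
      constructor
      · rintro (⟨p, ⟨hp, _⟩, rfl⟩ | ⟨p, ⟨hp, _⟩, rfl⟩) <;> exact ⟨p, hp, rfl⟩
      · rintro ⟨p, hp, rfl⟩
        cases hb : Nat.blt (wt w p.e) θ with
        | true => left; exact ⟨p, ⟨hp, hb⟩, rfl⟩
        | false => right; exact ⟨p, ⟨hp, by rw [hb]; rfl⟩, rfl⟩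
    rw [hun] at ht
    refine ⟨_, ht, ?_⟩
    rw [List.map_append, List.map_map]
    refine (hp1.append hp2).trans ?_
    rw [List.perm_iff_count]
    intro x
    simp only [List.count_append, List.count_replicate]
    split_ifs <;> omega
  · intro e he e' he'
    obtain ⟨p, hp, rfl⟩ := (mem_ES _ _).1 he
    obtain ⟨q, hq, rfl⟩ := (mem_ES _ _).1 he'
    rw [wgt_toFs, wgt_toFs]
    have h1 : wt w p.e < θ := Nat.le_of_ble_eq_true (List.mem_filter.1 hp).2
    have h2 : ¬ wt w q.e < θ := by
      intro hlt
      have h3 : Nat.blt (wt w q.e) θ = true := Nat.ble_eq_true_of_le hlt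
      have h4 := (List.mem_filter.1 hq).2
      rw [h3] at h4
      cases h4
    omega

theorem check_spec (us us' : List (List ℤ)) (hus : ∀ χ ∈ us, χ.length = 10)
    (hus' : ∀ χ ∈ us', χ.length = 20) (c : Cert) :
    ∀ D, Valid D → c.check us us' D = true → ∀ a ≤ c.size,
      Conf (ES D) a (2 * (c.size - a)) := by
  induction c with
  | piece rows => exact runQ_spec us us' hus hus' rows
  | cut w θ l r ihl ihr =>
    intro D hD h a ha
    rw [Cert.check, Bool.and_eq_true, Bool.and_eq_true, forceL_eq, forceL_eq] at h
    obtain ⟨⟨h1, h2⟩, h3⟩ := h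
    rw [Cert.size] at ha ⊢
    have hl := ihl _ (fun p hp => hD p (List.mem_filter.1 hp).1) h2 (min a l.size)
      (min_le_right _ _)
    have hr := ihr _ (fun p hp => hD p (List.mem_filter.1 hp).1) h3 (a - min a l.size) (by omega)
    have := Conf_cut w θ h1 D _ _ _ _ hl hr
    convert this using 1 <;> omega

theorem conf13 (c : Cert) (h : fullCheck c = true) (a : ℕ) (ha : a ≤ c.size) :
    Conf (ES (D13.map fun e => ⟨e, evec e⟩)) a (2 * (c.size - a)) := by
  rw [fullCheck, forceU_eq, forceU_eq, forceE_eq] at h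
  refine check_spec (units 10) (units 20) ?_ ?_ c _ ?_ h a ha
  · intro χ hχ
    obtain ⟨i, hi, rfl⟩ := List.mem_map.1 hχ
    have := List.mem_range.1 hi
    simp; omega
  · intro χ hχ
    obtain ⟨i, hi, rfl⟩ := List.mem_map.1 hχ
    have := List.mem_range.1 hi
    simp; omega
  · intro p hp
    obtain ⟨e, _, rfl⟩ := List.mem_map.1 hp
    rfl

theorem mem_D13 (e : Fin 4 →₀ ℕ) (he : ∑ j, e j = 13) :
    e ∈ ES (D13.map fun e => ⟨e, evec e⟩) := by
  rw [mem_ES]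
  rw [Fin.sum_univ_four] at he
  refine ⟨⟨⟨e 0, e 1, e 2, e 3⟩, evec ⟨e 0, e 1, e 2, e 3⟩⟩, ?_, ?_⟩
  · refine List.mem_map.2 ⟨⟨e 0, e 1, e 2, e 3⟩, ?_, rfl⟩
    simp only [D13, List.mem_flatMap, List.mem_range, List.mem_map]
    refine ⟨e 0, by omega, e 1, by omega, e 2, by omega, ?_⟩
    congr 1
    omega
  · ext j
    fin_cases j <;> simp [toFs]

/-- The relation expressing independence of the points. -/
def Indep (x y : ℕ × (Fin 4 → ℚ)) : Prop := ∃ i j, x.2 i * y.2 j ≠ x.2 j * y.2 i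

theorem Indep.symm {x y : ℕ × (Fin 4 → ℚ)} (h : Indep x y) : Indep y x := by
  obtain ⟨i, j, h⟩ := h
  exact ⟨j, i, fun h' => h (by linear_combination h')⟩

theorem Indep.linearIndependent {x y : ℕ × (Fin 4 → ℚ)} (h : Indep x y) :
    LinearIndependent ℚ ![x.2, y.2] := by
  obtain ⟨i, j, h⟩ := h
  rw [LinearIndependent.pair_iff]
  intro s t hst
  have hi := congrFun hst i
  have hj := congrFun hst j
  simp only [Pi.add_apply, Pi.smul_apply, smul_eq_mul, Pi.zero_apply] at hi hj
  have h0 : x.2 i * y.2 j - x.2 j * y.2 i ≠ 0 := sub_ne_zero.2 h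
  constructor
  · apply (mul_eq_zero.1 (?_ : s * (x.2 i * y.2 j - x.2 j * y.2 i) = 0)).resolve_right h0
    linear_combination y.2 j * hi - y.2 i * hj
  · apply (mul_eq_zero.1 (?_ : t * (x.2 i * y.2 j - x.2 j * y.2 i) = 0)).resolve_right h0
    linear_combination x.2 i * hj - x.2 j * hi

theorem exists_reorder {α β : Type} (f : α → β) (L : List α) (l : List β)
    (h : (L.map f).Perm l) : ∃ L' : List α, L'.Perm L ∧ L'.map f = l := by
  have h' : List.Forall₂ (fun b a => f a = b) (L.map f) L := by
    induction L with
    | nil => simp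
    | cons a L ih => simp
  obtain ⟨L', h1, h2⟩ := List.perm_comp_forall₂ h.symm h'
  refine ⟨L', h2, ?_⟩
  clear h h' h2
  induction h1 with
  | nil => rfl
  | cons h _ ih => simp [h, ih]

theorem vdim13 (a b : ℕ) (hab : 2 * a + b = 56) :
    vdim 13 (List.replicate a 4 ++ List.replicate b 3) = -1 := by
  have h1 : Nat.choose 16 3 = 560 := by decide
  have h2 : Nat.choose 6 3 = 20 := by decide
  have h3 : Nat.choose 5 3 = 10 := by decide
  simp [vdim, h1, h2, h3]
  omega

theorem nonSpecial13 (a b : ℕ) (hab : 2 * a + b = 56)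
    (h : Conf (ES (D13.map fun e => ⟨e, evec e⟩)) a b) :
    nonSpecial 13 (List.replicate a 4 ++ List.replicate b 3) := by
  have hv := vdim13 a b hab
  obtain ⟨L, ⟨⟨hne, hpw⟩, hL⟩, hp⟩ := h
  obtain ⟨L', hL', hmap⟩ := exists_reorder _ _ _ hp
  rw [← hmap] at hv ⊢
  have hpw' : L'.Pairwise Indep := (hL'.pairwise_iff fun h => Indep.symm h).2 hpw
  let pts : Fin (L'.map Prod.fst).length → Fin 4 → ℚ := fun i =>
    (L'.get (Fin.cast (by simp) i)).2
  have hsys : systemSpace 13 (L'.map Prod.fst) pts = ⊥ := by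
    rw [eq_bot_iff]
    intro f hf
    rw [systemSpace, Submodule.mem_inf, Submodule.mem_iInf] at hf
    obtain ⟨hf1, hf2⟩ := hf
    rw [Submodule.mem_bot]
    apply hL
    · intro e he
      apply mem_D13
      have := (mem_homogeneousSubmodule _ _).1 hf1 (mem_support_iff.1 he)
      simpa [Finsupp.weight_apply, Finsupp.sum_fintype] using this
    · intro x hx
      obtain ⟨i, hi⟩ := List.get_of_mem (hL'.mem_iff.2 hx)
      have := hf2 (Fin.cast (by simp) i)
      simp only [pts] at this
      rw [← hi]
      simpa using this
  refine ⟨pts, ?_, ?_, ?_⟩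
  · intro i h0
    exact hne _ (hL'.mem_iff.1 (List.get_mem L' (Fin.cast (by simp) i))) 0 (congrFun h0 0)
  · intro i j hij
    have := List.pairwise_iff_get.1 hpw'
    rcases lt_or_gt_of_ne hij with h | h
    · exact (this (Fin.cast (by simp) i) (Fin.cast (by simp) j) h).linearIndependent
    · exact (this (Fin.cast (by simp) j) (Fin.cast (by simp) i) h).symm.linearIndependent
  · rw [hsys, hv]
    simp

/-! ## The final computation -/

theorem cert_ok : fullCheck theCert = true := by decide +kernel

theorem cert_size : theCert.size = 28 := by decide +kernel

/-- `L_3(13; 4^{×a}, 3^{×b})` with `2a + b = 56` is non-special of virtual dimension `−1`. -/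
theorem nonSpecial_thirteen (a b : ℕ) (hab : 2 * a + b = 56) :
    nonSpecial 13 (List.replicate a 4 ++ List.replicate b 3) ∧
      vdim 13 (List.replicate a 4 ++ List.replicate b 3) = -1 := by
  refine ⟨nonSpecial13 a b hab ?_, vdim13 a b hab⟩
  have h := conf13 theCert cert_ok a (by rw [cert_size]; omega)
  rw [cert_size] at h
  have hb : b = 2 * (28 - a) := by omega
  rw [hb]
  exact h
end
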